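/- Fix an integer n ≥ 3 and let 𝔰 be a principal 𝔰𝔩₂-subalgebra of 𝔰𝔩ₙ(ℂ), i.e. the image of an injective Lie algebra homomorphism 𝔰𝔩₂(ℂ) → 𝔰𝔩ₙ(ℂ) obtained from an irreducible n-dimensional representation of 𝔰𝔩₂(ℂ). Then for every finite-dimensional complex irreducible representation V of 𝔰𝔩ₙ(ℂ), there exists an integer d with 0 ≤ d < n such that the restriction of V to 𝔰 contains the irreducible 𝔰𝔩₂-representation F_d of dimension d+1 as a subrepresentation. -/

import Mathlib

noncomputable section

open LieAlgebra.SpecialLinear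
open Module Module.End Matrix

section SlTwo

variable {V : Type*} [AddCommGroup V] [Module ℂ V]

/-- `x` shifts the eigenvalues of `h` by `c`. -/
def Shifts (h x : End ℂ V) (c : ℂ) : Prop := ∀ v, h (x v) = x (h v) + c • x v

theorem Shifts.pow_apply {h x : End ℂ V} {c : ℂ} (hx : Shifts h x c) {μ : ℂ} {v : V}
    (hv : h v = μ • v) (k : ℕ) : h ((x ^ k) v) = (μ + k * c) • (x ^ k) v := by
  induction k with
  | zero => simp [hv]
  | succ k ih =>
    rw [pow_succ', Module.End.mul_apply, hx, ih, map_smul, ← add_smul]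
    push_cast; ring_nf

theorem Shifts.exists_pow_eq_zero [FiniteDimensional ℂ V] {h x : End ℂ V} {c : ℂ}
    (hx : Shifts h x c) (hc : c ≠ 0) {μ : ℂ} {v : V} (hv : h v = μ • v) :
    ∃ k : ℕ, (x ^ k) v = 0 := by
  by_contra! H
  have hev : ∀ k : ℕ, h.HasEigenvalue (μ + k * c) := fun k =>
    Module.End.hasEigenvalue_of_hasEigenvector
      ⟨Module.End.mem_eigenspace_iff.2 (hx.pow_apply hv k), H k⟩
  have hinj : Function.Injective (fun k : ℕ => μ + k * c) := by
    intro a b hab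
    simpa [hc] using hab
  exact Set.infinite_of_injective_forall_mem hinj hev
    (Module.End.finite_hasEigenvalue h)

/-- The last nonzero vector in the string `v, x v, x² v, …`. -/
theorem exists_pow_ne_zero_of_pow_eq_zero {x : End ℂ V} {v : V} (hv : v ≠ 0)
    (hx : ∃ k : ℕ, (x ^ k) v = 0) : ∃ k : ℕ, (x ^ k) v ≠ 0 ∧ (x ^ (k + 1)) v = 0 := by
  classical
  obtain ⟨k, hk⟩ : ∃ k, Nat.find hx = k + 1 := by
    refine Nat.exists_eq_succ_of_ne_zero fun h0 => hv ?_
    simpa [h0] using Nat.find_spec hx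
  exact ⟨k, Nat.find_min hx (by omega), hk ▸ Nat.find_spec hx⟩

theorem Shifts.mapsTo_maxGenEigenspace {h x : End ℂ V} {c : ℂ} (hx : Shifts h x c) (μ : ℂ)
    {v : V} (hv : v ∈ h.maxGenEigenspace μ) : x v ∈ h.maxGenEigenspace (μ + c) := by
  rw [Module.End.mem_maxGenEigenspace] at hv ⊢
  obtain ⟨k, hk⟩ := hv
  refine ⟨k, ?_⟩
  suffices ∀ w, ((h - (μ + c) • (1 : End ℂ V)) ^ k) (x w) =
      x (((h - μ • (1 : End ℂ V)) ^ k) w) by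
    rw [this, hk, map_zero]
  clear hk
  induction k with
  | zero => simp
  | succ k ih =>
    intro w
    rw [pow_succ, pow_succ, Module.End.mul_apply, Module.End.mul_apply, ← ih]
    congr 1
    simp only [LinearMap.sub_apply, LinearMap.smul_apply, Module.End.one_apply, hx w, map_sub,
      map_smul]
    module

theorem exists_eigenvector_mem {h : End ℂ V} {K : Submodule ℂ V} (hK : ∀ v ∈ K, h v ∈ K)
    {μ : ℂ} {v : V} (hvK : v ∈ K) (hv0 : v ≠ 0) (hv : v ∈ h.maxGenEigenspace μ) :
    ∃ w ∈ K, w ≠ 0 ∧ h w = μ • w := by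
  rw [Module.End.mem_maxGenEigenspace] at hv
  obtain ⟨k, hk, hk'⟩ := exists_pow_ne_zero_of_pow_eq_zero hv0 hv
  refine ⟨_, ?_, hk, ?_⟩
  · clear hk hk'
    induction k with
    | zero => simpa
    | succ k ih =>
      rw [pow_succ', Module.End.mul_apply]
      exact K.sub_mem (hK _ ih) (K.smul_mem _ ih)
  · rw [pow_succ', Module.End.mul_apply] at hk'
    have hw := sub_eq_zero.1 hk'
    exact hw

/-- Operators `h, e, f` on `V` satisfying the relations of the standard basis of `𝔰𝔩₂`. -/
structure IsSl2 (h e f : End ℂ V) : Prop where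
  he : Shifts h e 2
  hf : Shifts h f (-2)
  ef : ∀ v, e (f v) = f (e v) + h v

theorem IsSl2.symm {h e f : End ℂ V} (t : IsSl2 h e f) : IsSl2 (-h) f e where
  he v := by simp [t.hf v, add_comm]
  hf v := by simp [t.he v, add_comm]
  ef v := by simp [t.ef v]

theorem IsSl2.e_pow_f {h e f : End ℂ V} (t : IsSl2 h e f) {μ : ℂ} {v : V} (hv : h v = μ • v)
    (hev : e v = 0) (k : ℕ) :
    e ((f ^ (k + 1)) v) = ((k + 1) * (μ - k)) • (f ^ k) v := by
  induction k with
  | zero => simp [t.ef, hev, hv]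
  | succ k ih =>
    rw [pow_succ', Module.End.mul_apply, t.ef, ih, t.hf.pow_apply hv, map_smul,
      ← Module.End.mul_apply, ← pow_succ', ← add_smul]
    push_cast; ring_nf

theorem IsSl2.exists_nat [FiniteDimensional ℂ V] {h e f : End ℂ V} (t : IsSl2 h e f) {μ : ℂ}
    {v : V} (hv0 : v ≠ 0) (hv : h v = μ • v) (hev : e v = 0) :
    ∃ d : ℕ, μ = d ∧ (f ^ d) v ≠ 0 ∧ (f ^ (d + 1)) v = 0 := by
  obtain ⟨k, hk, hk'⟩ := exists_pow_ne_zero_of_pow_eq_zero hv0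
    (t.hf.exists_pow_eq_zero (by norm_num) hv)
  refine ⟨k, ?_, hk, hk'⟩
  have h1 := t.e_pow_f hv hev k
  rw [hk', map_zero, eq_comm, smul_eq_zero_iff_left hk] at h1
  have h2 : ((k : ℂ) + 1) ≠ 0 := by exact_mod_cast k.succ_ne_zero
  exact sub_eq_zero.1 ((mul_eq_zero.1 h1).resolve_left h2)

theorem exists_lowestWeight_of_functional [FiniteDimensional ℂ V] {h e f : End ℂ V}
    (t : IsSl2 h e f) (ξ : V →ₗ[ℂ] ℂ) (hξ : ξ ≠ 0) (d : ℕ)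
    (hh : ∀ v, ξ (h v) = -d * ξ v) (he : ∀ v, ξ (e v) = 0) :
    ∃ v, v ≠ 0 ∧ h v = (-d : ℂ) • v ∧ f v = 0 := by
  set A := h.maxGenEigenspace (-d : ℂ) with hA
  set C := h.maxGenEigenspace (-d + -2 : ℂ) with hC
  have stab : ∀ μ : ℂ, ∀ v ∈ h.maxGenEigenspace μ, h v ∈ h.maxGenEigenspace μ := fun μ v hv =>
    Module.End.mapsTo_maxGenEigenspace_of_comm (Commute.refl h) μ hv
  have hfA : ∀ v ∈ A, f v ∈ C := fun v hv => t.hf.mapsTo_maxGenEigenspace _ hv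
  have heC : ∀ v ∈ C, e v ∈ A := fun v hv => by
    have := t.he.mapsTo_maxGenEigenspace _ hv
    simpa [hA] using this
  have hξA : ∃ v ∈ A, ξ v ≠ 0 := by
    by_contra! H
    refine hξ (LinearMap.ker_eq_top.1 (top_le_iff.1 ?_))
    rw [← Module.End.iSup_maxGenEigenspace_eq_top h, iSup_le_iff]
    intro μ v hv
    by_cases hμ : μ = -d
    · subst hμ; exact H v hv
    · rw [Module.End.mem_maxGenEigenspace] at hv
      obtain ⟨k, hk⟩ := hv
      have : ∀ w, ξ (((h - μ • (1 : End ℂ V)) ^ k) w) = (-d - μ) ^ k * ξ w := by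
        clear hk
        induction k with
        | zero => simp
        | succ k ih =>
          intro w
          rw [pow_succ, Module.End.mul_apply, ih]
          simp [hh]; ring
      have h1 := this v
      rw [hk, map_zero, eq_comm, mul_eq_zero] at h1
      exact h1.resolve_left (pow_ne_zero _ (sub_ne_zero.2 (Ne.symm hμ)))
  let eC : C →ₗ[ℂ] A := e.restrict heC
  let fA : A →ₗ[ℂ] C := f.restrict hfA
  have hinj : Function.Injective eC := by
    rw [← LinearMap.ker_eq_bot, Submodule.eq_bot_iff]
    rintro ⟨v, hv⟩ hev
    have hev' : e v = 0 := congrArg Subtype.val hev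
    by_contra hne
    have hv0 : v ≠ 0 := fun h0 => hne (by simp [h0])
    obtain ⟨w, hw, hw0, hhw⟩ := exists_eigenvector_mem (h := h) (K := LinearMap.ker e)
      (μ := -d + -2) (fun v hv => by
        have := t.he v
        rw [LinearMap.mem_ker] at hv ⊢
        simpa [hv, eq_comm] using this) hev' hv0 hv
    obtain ⟨N, hN, -⟩ := t.exists_nat hw0 hhw hw
    have : ((d + 2 + N : ℕ) : ℂ) = 0 := by push_cast; rw [← hN]; ring
    exact absurd (Nat.cast_eq_zero.1 this) (by omega)
  have hnsurj : ¬ Function.Surjective eC := by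
    intro hs
    obtain ⟨v, hv, hv'⟩ := hξA
    obtain ⟨w, hw⟩ := hs ⟨v, hv⟩
    have : e w = v := congrArg Subtype.val hw
    exact hv' (this ▸ he w)
  have hninj : ¬ Function.Injective fA := by
    intro hi
    have h1 := LinearMap.finrank_le_finrank_of_injective hi
    have h2 := LinearMap.finrank_le_finrank_of_injective hinj
    exact hnsurj ((LinearMap.injective_iff_surjective_of_finrank_eq_finrank (le_antisymm h2 h1)).1
      hinj)
  rw [← LinearMap.ker_eq_bot, Submodule.eq_bot_iff] at hninj
  push Not at hninj
  obtain ⟨⟨v, hv⟩, hfv, hv0⟩ := hninj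
  have hfv' : f v = 0 := congrArg Subtype.val hfv
  obtain ⟨w, hw, hw0, hhw⟩ := exists_eigenvector_mem (h := h) (K := LinearMap.ker f)
      (μ := -d) (fun v hv => by
        have := t.hf v
        rw [LinearMap.mem_ker] at hv ⊢
        simpa [hv, eq_comm] using this) hfv' (fun h0 => hv0 (by simp [h0])) hv
  exact ⟨w, hw0, hhw, hw⟩

theorem exists_lowestWeight_of_functional_pow [FiniteDimensional ℂ V] {h e f : End ℂ V}
    (t : IsSl2 h e f) (ξ : V →ₗ[ℂ] ℂ) (hξ : ξ ≠ 0) (m q : ℕ)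
    (hh : ∀ v, ξ (h v) = -m * ξ v) (he : ∀ v, ξ ((e ^ q) v) = 0) :
    ∃ i < q, ∃ v, v ≠ 0 ∧ h v = (-(m + 2 * i : ℕ) : ℂ) • v ∧ f v = 0 := by
  classical
  have hex : ∃ q, ∀ v, ξ ((e ^ q) v) = 0 := ⟨q, he⟩
  obtain ⟨i, hi⟩ : ∃ k, Nat.find hex = k + 1 := by
    refine Nat.exists_eq_succ_of_ne_zero fun h0 => hξ (LinearMap.ext fun v => ?_)
    have := Nat.find_spec hex v
    simpa [h0] using this
  have h1 := Nat.find_spec hex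
  have h2 := Nat.find_min hex (m := i) (by omega)
  have h3 := Nat.find_min' hex he
  rw [hi] at h1 h3
  refine ⟨i, by omega, exists_lowestWeight_of_functional t (ξ ∘ₗ (e ^ i)) ?_ _ ?_ ?_⟩
  · intro h0; exact h2 fun v => LinearMap.congr_fun h0 v
  · suffices ∀ k : ℕ, ∀ v, ξ ((e ^ k) (h v)) = (-(m + 2 * k : ℕ) : ℂ) * ξ ((e ^ k) v) from this i
    intro k
    induction k with
    | zero => simpa using hh
    | succ k ih =>
      intro v
      have := t.he v
      rw [pow_succ, Module.End.mul_apply, Module.End.mul_apply, ← sub_eq_iff_eq_add.2 this,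
        map_sub, map_sub, ih, map_smul, map_smul]
      push_cast; simp only [smul_eq_mul]; ring
  · intro v
    simpa [pow_succ] using h1 v

/-- The string of a primitive vector of weight `d` spans an irreducible submodule of dimension
`d + 1`. -/
theorem IsSl2.exists_irreducible [FiniteDimensional ℂ V] {h e f : End ℂ V} (t : IsSl2 h e f)
    {d : ℕ} {v : V} (hv0 : v ≠ 0) (hv : h v = (d : ℂ) • v) (hev : e v = 0) :
    ∃ U : Submodule ℂ V, ((∀ w ∈ U, h w ∈ U) ∧ (∀ w ∈ U, e w ∈ U) ∧ (∀ w ∈ U, f w ∈ U)) ∧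
      U ≠ ⊥ ∧ (∀ U' : Submodule ℂ V, U' ≤ U →
        ((∀ w ∈ U', h w ∈ U') ∧ (∀ w ∈ U', e w ∈ U') ∧ (∀ w ∈ U', f w ∈ U')) →
        U' = ⊥ ∨ U' = U) ∧ Module.finrank ℂ U = d + 1 ∧
      LinearIndependent ℂ (fun k : Fin (d + 1) => (f ^ (k : ℕ)) v) ∧ (f ^ (d + 1)) v = 0 := by
  obtain ⟨d', hd', hne, hz⟩ := t.exists_nat hv0 hv hev
  obtain rfl : d = d' := by exact_mod_cast hd'
  have hnz : ∀ k : ℕ, k ≤ d → (f ^ k) v ≠ 0 := by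
    intro k hk h0
    apply hne
    rw [← Nat.sub_add_cancel hk, pow_add, Module.End.mul_apply, h0, map_zero]
  set s : Fin (d + 1) → V := fun k => (f ^ (k : ℕ)) v with hs
  have hli : LinearIndependent ℂ s := by
    refine Module.End.eigenvectors_linearIndependent' h (fun k : Fin (d + 1) => (d + k * (-2) : ℂ)) ?_ s ?_
    · intro a b hab
      simpa [Fin.ext_iff] using hab
    · intro k
      exact ⟨Module.End.mem_eigenspace_iff.2 (t.hf.pow_apply hv k), hnz k (by omega)⟩
  have hspan : ∀ (x : End ℂ V), (∀ k, x (s k) ∈ Submodule.span ℂ (Set.range s)) →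
      ∀ w ∈ Submodule.span ℂ (Set.range s), x w ∈ Submodule.span ℂ (Set.range s) := by
    intro x hx w hw
    induction hw using Submodule.span_induction with
    | mem w hw => obtain ⟨k, rfl⟩ := hw; exact hx k
    | zero => simp
    | add a b _ _ ha hb => rw [map_add]; exact Submodule.add_mem _ ha hb
    | smul c a _ ha => rw [map_smul]; exact Submodule.smul_mem _ _ ha
  have hmem : ∀ k, s k ∈ Submodule.span ℂ (Set.range s) := fun k =>
    Submodule.subset_span ⟨k, rfl⟩
  have hvs : s 0 = v := by simp [hs]
  refine ⟨Submodule.span ℂ (Set.range s), ⟨hspan _ ?_, hspan _ ?_, hspan _ ?_⟩, ?_, ?_, ?_, hli, hz⟩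
  · intro k
    rw [hs]; dsimp only
    rw [t.hf.pow_apply hv]
    exact Submodule.smul_mem _ _ (hmem k)
  · intro k
    refine Fin.cases ?_ (fun k => ?_) k
    · simp [hvs, hev]
    · have := t.e_pow_f hv hev k
      rw [hs]; simp only [Fin.val_succ]
      rw [this]
      exact Submodule.smul_mem _ _ (hmem k.castSucc)
  · intro k
    refine Fin.lastCases ?_ (fun k => ?_) k
    · have : f (s (Fin.last d)) = 0 := by
        rw [← hz, pow_succ', Module.End.mul_apply]; rfl
      rw [this]; exact Submodule.zero_mem _
    · have : f (s k.castSucc) = s k.succ := by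
        simp [hs, pow_succ']
      rw [this]; exact hmem _
  · intro h0
    exact hv0 ((Submodule.mem_bot ℂ).1 (h0 ▸ hvs ▸ hmem 0))
  · rintro U' hU' ⟨hh, he, hf⟩
    refine or_iff_not_imp_left.2 fun hbot => le_antisymm hU' ?_
    suffices hvU : v ∈ U' by
      rw [Submodule.span_le]
      rintro _ ⟨k, rfl⟩
      have : ∀ k : ℕ, (f ^ k) v ∈ U' := by
        intro k
        induction k with
        | zero => simpa
        | succ k ih => rw [pow_succ', Module.End.mul_apply]; exact hf _ ih
      exact this k
    obtain ⟨w, hw, hw0⟩ := Submodule.exists_mem_ne_zero_of_ne_bot hbot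
    have hnt : Nontrivial U' := ⟨⟨w, hw⟩, 0, fun h => hw0 (congrArg Subtype.val h)⟩
    obtain ⟨μ, hμ⟩ := Module.End.exists_eigenvalue (h.restrict hh)
    obtain ⟨⟨w, hw⟩, hhw⟩ := hμ.exists_hasEigenvector
    have hw0 : w ≠ 0 := fun h => hhw.2 (by simp [h])
    have hhw' : h w = μ • w := congrArg Subtype.val hhw.apply_eq_smul
    obtain ⟨k, hk, hk'⟩ := exists_pow_ne_zero_of_pow_eq_zero hw0
      (t.he.exists_pow_eq_zero (by norm_num) hhw')
    have hkU : (e ^ k) w ∈ U' := by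
      clear hk hk'
      induction k with
      | zero => simpa
      | succ k ih => rw [pow_succ', Module.End.mul_apply]; exact he _ ih
    set x := (e ^ k) w
    have hex : e x = 0 := by rwa [pow_succ', Module.End.mul_apply] at hk'
    obtain ⟨c, hc⟩ := (Submodule.mem_span_range_iff_exists_fun ℂ).1 (hU' hkU)
    have hcz : ∀ k : Fin d, c k.succ = 0 := by
      have h1 : ∑ k : Fin d, (c k.succ * ((k + 1) * (d - k) : ℂ)) • s k.castSucc = 0 := by
        rw [← hex, ← hc, map_sum, Fin.sum_univ_succ, map_smul, hvs, hev, smul_zero, zero_add]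
        refine Finset.sum_congr rfl fun k _ => ?_
        rw [map_smul, mul_smul]
        congr 1
        simp only [hs, Fin.val_succ, Fin.val_castSucc]
        rw [t.e_pow_f hv hev]
      have h2 := hli.comp _ (Fin.castSucc_injective d)
      intro k
      have h3 := (Fintype.linearIndependent_iff.1 h2) _ h1 k
      have h4 : ((k : ℂ) + 1) ≠ 0 := by exact_mod_cast k.1.succ_ne_zero
      have h5 : ((d : ℂ) - (k : ℕ)) ≠ 0 := by
        rw [sub_ne_zero]; exact_mod_cast k.2.ne'
      exact (mul_eq_zero.1 h3).resolve_right (mul_ne_zero h4 h5)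
    have hxc : x = c 0 • v := by
      rw [← hc, Fin.sum_univ_succ, hvs]
      simp [hcz]
    have hc0 : c 0 ≠ 0 := fun h => hk (by rw [hxc, h, zero_smul])
    have : v = (c 0)⁻¹ • x := by rw [hxc, smul_smul, inv_mul_cancel₀ hc0, one_smul]
    rw [this]; exact U'.smul_mem _ hkU
  · rw [finrank_span_eq_card hli, Fintype.card_fin]

end SlTwo

section MatrixRep

variable {V : Type*} [AddCommGroup V] [Module ℂ V] {ι : Type*} [Fintype ι] [DecidableEq ι]

/-- `ρ` is a representation of the Lie algebra of all matrices. -/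
def IsRep (ρ : Matrix ι ι ℂ →ₗ[ℂ] End ℂ V) : Prop :=
  ∀ X Y v, ρ X (ρ Y v) = ρ Y (ρ X v) + ρ (X * Y - Y * X) v

theorem single_commutator (p q k l : ι) :
    single p q (1 : ℂ) * single k l 1 - single k l 1 * single p q 1 =
      (if q = k then single p l 1 else 0) - (if l = p then single k q 1 else 0) := by
  congr 1
  · split_ifs with h
    · subst h; simp
    · exact Matrix.single_mul_single_of_ne _ _ _ _ h _
  · split_ifs with h
    · subst h; simp
    · exact Matrix.single_mul_single_of_ne _ _ _ _ h _

theorem IsRep.single_apply {ρ : Matrix ι ι ℂ →ₗ[ℂ] End ℂ V} (hρ : IsRep ρ) (p q k l : ι) (v : V) :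
    ρ (single p q 1) (ρ (single k l 1) v) = ρ (single k l 1) (ρ (single p q 1) v) +
      ((if q = k then ρ (single p l 1) v else 0) - (if l = p then ρ (single k q 1) v else 0)) := by
  rw [hρ, single_commutator, map_sub, LinearMap.sub_apply]
  congr 2
  · split_ifs <;> simp
  · split_ifs <;> simp

theorem IsRep.diagonal_shifts {ρ : Matrix ι ι ℂ →ₗ[ℂ] End ℂ V} (hρ : IsRep ρ) (d : ι → ℂ)
    (i j : ι) : Shifts (ρ (diagonal d)) (ρ (single i j 1)) (d i - d j) := by
  intro v
  rw [hρ, ← LinearMap.smul_apply, ← map_smul]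
  congr 3
  ext a b
  simp [Matrix.single_apply]
  grind

theorem IsRep.isSl2 {ρ : Matrix ι ι ℂ →ₗ[ℂ] End ℂ V} (hρ : IsRep ρ) {i j : ι} (hij : i ≠ j) :
    IsSl2 (ρ (single i i 1) - ρ (single j j 1)) (ρ (single i j 1)) (ρ (single j i 1)) where
  he v := by
    rw [LinearMap.sub_apply, hρ.single_apply i i i j, hρ.single_apply j j i j]
    simp only [LinearMap.sub_apply, map_sub, if_neg hij.symm, if_pos]
    module
  hf v := by
    rw [LinearMap.sub_apply, hρ.single_apply i i j i, hρ.single_apply j j j i]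
    simp only [LinearMap.sub_apply, map_sub, if_neg hij, if_pos]
    module
  ef v := by
    rw [hρ.single_apply i j j i]
    simp

/-- Twist of `ρ` by a multiple of the trace. -/
def twist (ρ : Matrix ι ι ℂ →ₗ[ℂ] End ℂ V) (κ : ℂ) : Matrix ι ι ℂ →ₗ[ℂ] End ℂ V :=
  ρ + (Matrix.traceLinearMap ι ℂ ℂ).smulRight (κ • (1 : End ℂ V))

theorem twist_apply (ρ : Matrix ι ι ℂ →ₗ[ℂ] End ℂ V) (κ : ℂ) (X : Matrix ι ι ℂ) (v : V) :
    twist ρ κ X v = ρ X v + (X.trace * κ) • v := by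
  simp [twist, mul_smul]

theorem IsRep.twist {ρ : Matrix ι ι ℂ →ₗ[ℂ] End ℂ V} (hρ : IsRep ρ) (κ : ℂ) :
    IsRep (twist ρ κ) := by
  intro X Y v
  simp only [twist_apply, map_add, map_smul, hρ X Y v, Matrix.trace_sub, Matrix.trace_mul_comm X Y,
    sub_self, zero_mul, zero_smul]
  module

theorem exists_common_eigenvector [FiniteDimensional ℂ V] {κ : Type*} (s : Finset κ)
    (F : κ → End ℂ V) (hF : ∀ i j v, F i (F j v) = F j (F i v)) (W : Submodule ℂ V) (hW : W ≠ ⊥)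
    (hst : ∀ i, ∀ v ∈ W, F i v ∈ W) :
    ∃ v ∈ W, v ≠ 0 ∧ ∃ χ : κ → ℂ, ∀ i ∈ s, F i v = χ i • v := by
  classical
  induction s using Finset.induction_on generalizing W with
  | empty =>
    obtain ⟨v, hv, hv0⟩ := Submodule.exists_mem_ne_zero_of_ne_bot hW
    exact ⟨v, hv, hv0, fun _ => 0, by simp⟩
  | insert a s _ ih =>
    obtain ⟨w, hw, hw0⟩ := Submodule.exists_mem_ne_zero_of_ne_bot hW
    have hnt : Nontrivial W := ⟨⟨w, hw⟩, 0, fun h => hw0 (congrArg Subtype.val h)⟩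
    obtain ⟨μ, hμ⟩ := Module.End.exists_eigenvalue ((F a).restrict (hst a))
    obtain ⟨⟨w, hw⟩, hhw⟩ := hμ.exists_hasEigenvector
    have hw0 : w ≠ 0 := fun h => hhw.2 (by simp [h])
    have hhw' : F a w = μ • w := congrArg Subtype.val hhw.apply_eq_smul
    obtain ⟨v, hv, hv0, χ, hχ⟩ := ih (W ⊓ (F a).eigenspace μ)
      (fun h => hw0 ((Submodule.mem_bot ℂ).1
        (h ▸ ⟨hw, Module.End.mem_eigenspace_iff.2 hhw'⟩)))
      (fun i v hv => ⟨hst i v hv.1, by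
        have := hv.2
        rw [SetLike.mem_coe, Module.End.mem_eigenspace_iff] at this ⊢
        rw [hF, this, map_smul]⟩)
    refine ⟨v, hv.1, hv0, Function.update χ a μ, fun i hi => ?_⟩
    by_cases hia : i = a
    · subst hia
      simpa using Module.End.mem_eigenspace_iff.1 hv.2
    · rw [Function.update_of_ne hia]
      exact hχ i ((Finset.mem_insert.1 hi).resolve_left hia)

variable {n : ℕ}

/-- `v` is killed by strictly upper triangular matrices and has weight `χ`. -/
structure IsHighest (ρ : Matrix (Fin n) (Fin n) ℂ →ₗ[ℂ] End ℂ V) (χ : Fin n → ℂ) (v : V) :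
    Prop where
  upper : ∀ i j, i < j → ρ (single i j 1) v = 0
  diag : ∀ i, ρ (single i i 1) v = χ i • v

theorem IsHighest.diagonal {ρ : Matrix (Fin n) (Fin n) ℂ →ₗ[ℂ] End ℂ V} {χ : Fin n → ℂ} {v : V}
    (hv : IsHighest ρ χ v) (d : Fin n → ℂ) : ρ (Matrix.diagonal d) v = (∑ i, d i * χ i) • v := by
  have : Matrix.diagonal d = ∑ i, d i • single i i (1 : ℂ) := by
    rw [← Matrix.sum_single_eq_diagonal]; simp
  rw [this, map_sum, LinearMap.sum_apply, Finset.sum_smul]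
  simp only [map_smul, LinearMap.smul_apply, hv.diag, mul_smul]

theorem IsRep.exists_isHighest [FiniteDimensional ℂ V] [Nontrivial V]
    {ρ : Matrix (Fin n) (Fin n) ℂ →ₗ[ℂ] End ℂ V} (hρ : IsRep ρ) :
    ∃ χ v, v ≠ 0 ∧ IsHighest ρ χ v := by
  set D := ρ (Matrix.diagonal fun i : Fin n => -(i : ℂ)) with hD
  obtain ⟨μ, hμ⟩ := Module.End.exists_eigenvalue D
  have hinj : Function.Injective (fun k : ℕ => μ + k) := by
    intro a b hab
    simpa using hab
  have hfin : {k : ℕ | D.HasEigenvalue (μ + k)}.Finite :=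
    Set.Finite.preimage hinj.injOn (Module.End.finite_hasEigenvalue D)
  obtain ⟨k, hk, hmax⟩ := hfin.exists_maximal ⟨0, by simpa using hμ⟩
  obtain ⟨w, hw⟩ := Module.End.HasEigenvalue.exists_hasEigenvector hk
  let W : Submodule ℂ V := ⨅ (i : Fin n) (j : Fin n) (_ : i < j), LinearMap.ker (ρ (single i j 1))
  have hWmem : ∀ v, v ∈ W ↔ ∀ i j, i < j → ρ (single i j 1) v = 0 := by
    intro v; simp [W, Submodule.mem_iInf]
  have hwW : w ∈ W := by
    rw [hWmem]
    intro i j hij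
    by_contra hne
    have h1 := hρ.diagonal_shifts (fun i : Fin n => -(i : ℂ)) i j w
    rw [← hD, hw.apply_eq_smul, map_smul, ← add_smul] at h1
    have h2 : D.HasEigenvalue (μ + ((k + (j - i) : ℕ))) := by
      refine Module.End.hasEigenvalue_of_hasEigenvector
        ⟨Module.End.mem_eigenspace_iff.2 (h1.trans ?_), hne⟩
      congr 1
      push_cast [Nat.cast_sub (show (i : ℕ) ≤ j from hij.le)]
      ring
    have h3 := hmax h2 (by omega)
    have : (i : ℕ) < j := hij
    simp at h3
    omega
  obtain ⟨v, hv, hv0, χ, hχ⟩ := exists_common_eigenvector Finset.univ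
    (fun i => ρ (single i i 1)) (fun i j v => by
      simp only [hρ.single_apply i i j j]
      by_cases h : i = j
      · subst h; simp
      · simp [h, Ne.symm h]) W
    (fun h => hw.2 ((Submodule.mem_bot ℂ).1 (h ▸ hwW)))
    (fun k v hv => by
      rw [hWmem] at hv ⊢
      intro i j hij
      rw [hρ.single_apply, hv i j hij, map_zero, zero_add]
      split_ifs with h1 h2
      · omega
      · rw [← h1, hv i j hij]; simp
      · rename_i h2; rw [h2, hv i j hij]; simp
      · simp)
  exact ⟨χ, v, hv0, (hWmem v).1 hv, fun i => hχ i (Finset.mem_univ i)⟩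

theorem IsHighest.exists_nat_weight [FiniteDimensional ℂ V]
    {ρ : Matrix (Fin (n + 1)) (Fin (n + 1)) ℂ →ₗ[ℂ] End ℂ V} (hρ : IsRep ρ) {χ v} (hv0 : v ≠ 0)
    (hv : IsHighest ρ χ v) :
    ∃ (l : Fin (n + 1) → ℕ) (κ : ℂ), Antitone l ∧ ∀ i, χ i = l i + κ := by
  have key : ∀ i j, i ≤ j → ∃ d : ℕ, χ i - χ j = d := by
    intro i j hij
    rcases hij.eq_or_lt with rfl | hij
    · exact ⟨0, by simp⟩
    · obtain ⟨d, hd, -⟩ := (hρ.isSl2 hij.ne).exists_nat (μ := χ i - χ j) hv0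
        (by simp [hv.diag, sub_smul]) (hv.upper i j hij)
      exact ⟨d, hd⟩
  choose l hl using fun i => key i (Fin.last n) (Fin.le_last i)
  refine ⟨l, χ (Fin.last n), fun i j hij => ?_, fun i => by rw [← hl]; ring⟩
  obtain ⟨d, hd⟩ := key i j hij
  have : (l i : ℂ) = l j + d := by rw [← hl, ← hl, ← hd]; ring
  have : l i = l j + d := by exact_mod_cast this
  omega

theorem IsHighest.twist {ρ : Matrix (Fin n) (Fin n) ℂ →ₗ[ℂ] End ℂ V} {χ v}
    (hv : IsHighest ρ χ v) (κ : ℂ) : IsHighest (twist ρ κ) (fun i => χ i + κ) v where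
  upper i j hij := by
    rw [twist_apply, hv.upper i j hij, Matrix.trace_single_eq_of_ne _ _ _ hij.ne]; simp
  diag i := by
    rw [twist_apply, hv.diag, Matrix.trace_single_eq_same]; module

/-- `ρ` with permuted coordinates. -/
def permRep (ρ : Matrix (Fin n) (Fin n) ℂ →ₗ[ℂ] End ℂ V) (σ : Equiv.Perm (Fin n)) :
    Matrix (Fin n) (Fin n) ℂ →ₗ[ℂ] End ℂ V :=
  ρ ∘ₗ (Matrix.reindexLinearEquiv ℂ ℂ σ σ).toLinearMap

theorem permRep_apply (ρ : Matrix (Fin n) (Fin n) ℂ →ₗ[ℂ] End ℂ V) (σ : Equiv.Perm (Fin n))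
    (X : Matrix (Fin n) (Fin n) ℂ) : permRep ρ σ X = ρ (X.submatrix σ.symm σ.symm) := rfl

theorem permRep_single (ρ : Matrix (Fin n) (Fin n) ℂ →ₗ[ℂ] End ℂ V) (σ : Equiv.Perm (Fin n))
    (i j : Fin n) : permRep ρ σ (single i j 1) = ρ (single (σ i) (σ j) 1) := by
  rw [permRep_apply]; congr 1
  ext a b
  simp [Matrix.single_apply, Equiv.eq_symm_apply]

theorem IsRep.permRep {ρ : Matrix (Fin n) (Fin n) ℂ →ₗ[ℂ] End ℂ V} (hρ : IsRep ρ)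
    (σ : Equiv.Perm (Fin n)) : IsRep (permRep ρ σ) := by
  intro X Y v
  simp only [permRep_apply]
  rw [hρ, Matrix.submatrix_mul_equiv, Matrix.submatrix_mul_equiv]
  rfl

theorem permRep_mul (ρ : Matrix (Fin n) (Fin n) ℂ →ₗ[ℂ] End ℂ V) (σ τ : Equiv.Perm (Fin n)) :
    permRep ρ (σ * τ) = permRep (permRep ρ σ) τ := by
  ext X : 1
  simp [permRep_apply, Matrix.submatrix_submatrix]
  rfl

theorem IsHighest.swap [FiniteDimensional ℂ V]
    {ρ : Matrix (Fin (n + 1)) (Fin (n + 1)) ℂ →ₗ[ℂ] End ℂ V} (hρ : IsRep ρ)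
    {l : Fin (n + 1) → ℕ} {v : V} (hv0 : v ≠ 0) (hv : IsHighest ρ (fun i => (l i : ℂ)) v)
    (i : Fin n) :
    ∃ w, w ≠ 0 ∧ IsHighest (permRep ρ (Equiv.swap i.castSucc i.succ)) (fun i => (l i : ℂ)) w := by
  have hii : i.castSucc < i.succ := Fin.castSucc_lt_succ
  set p := i.castSucc with hp
  set q := i.succ with hq
  have hpq : (q : ℕ) = p + 1 := by simp [hp, hq]
  obtain ⟨a, ha, hne, hz⟩ := (hρ.isSl2 hii.ne).exists_nat (μ := l p - l q) hv0
        (by simp [hv.diag, sub_smul]) (hv.upper p q hii)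
  set f := ρ (single q p 1) with hf
  have hup : ∀ k : ℕ, ∀ r s, r < s → ¬ (r = p ∧ s = q) → ρ (single r s 1) ((f ^ k) v) = 0 := by
    intro k
    induction k with
    | zero => intro r s hrs _; exact hv.upper r s hrs
    | succ k ih =>
      intro r s hrs hne
      rw [pow_succ', Module.End.mul_apply, hf, hρ.single_apply, ← hf, ih r s hrs hne, map_zero,
        zero_add]
      have h1 : s = q → ρ (single r p 1) ((f ^ k) v) = 0 := fun h =>
        ih r p (by grind) (by grind)
      have h2 : p = r → ρ (single q s 1) ((f ^ k) v) = 0 := fun h =>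
        ih q s (by grind) (by grind)
      split_ifs <;> simp_all
  have hsh : ∀ r, Shifts (ρ (single r r 1)) f ((if r = q then 1 else 0) - if r = p then 1 else 0) := by
    intro r v
    rw [hf, hρ.single_apply]
    congr 1
    rw [sub_smul]
    by_cases h1 : r = q
    · simp [h1, hii.ne, hii.ne']
    · by_cases h2 : r = p
      · simp [h2, hii.ne]
      · simp [h1, h2, Ne.symm h2]
  refine ⟨(f ^ a) v, hne, fun r s hrs => ?_, fun r => ?_⟩
  · rw [permRep_single]
    by_cases h : r = p ∧ s = q
    · rw [h.1, h.2, Equiv.swap_apply_left, Equiv.swap_apply_right, ← hf, ← Module.End.mul_apply,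
        ← pow_succ', hz]
    · apply hup
      · simp only [Equiv.swap_apply_def]; grind
      · simp only [Equiv.swap_apply_def]; grind
  · rw [permRep_single, (hsh _).pow_apply (hv.diag _), ← ha]
    congr 1
    by_cases h1 : r = q
    · subst h1; simp [hii.ne]
    · by_cases h2 : r = p
      · rw [h2]; simp [hii.ne']
      · rw [Equiv.swap_apply_of_ne_of_ne h2 h1]; simp [h1, h2]

/-- Highest weights do not depend on the ordering of the coordinates. -/
theorem IsHighest.perm [FiniteDimensional ℂ V]
    {ρ : Matrix (Fin (n + 1)) (Fin (n + 1)) ℂ →ₗ[ℂ] End ℂ V} (hρ : IsRep ρ)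
    {l : Fin (n + 1) → ℕ} {v : V} (hv0 : v ≠ 0) (hv : IsHighest ρ (fun i => (l i : ℂ)) v)
    (σ : Equiv.Perm (Fin (n + 1))) :
    ∃ w, w ≠ 0 ∧ IsHighest (permRep ρ σ) (fun i => (l i : ℂ)) w := by
  have hσ : σ ∈ Submonoid.closure
      (Set.range fun i : Fin n => Equiv.swap i.castSucc i.succ) := by
    rw [Equiv.Perm.mclosure_swap_castSucc_succ]; trivial
  induction hσ using Submonoid.closure_induction_right with
  | one => exact ⟨v, hv0, by simpa [permRep_single] using hv.upper,
      by simpa [permRep_single] using hv.diag⟩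
  | mul_right σ _ τ hτ ih =>
    obtain ⟨i, rfl⟩ := hτ
    obtain ⟨w, hw0, hw⟩ := ih
    rw [permRep_mul]
    exact hw.swap (hρ.permRep σ) hw0 i

end MatrixRep

section Intertwiner

variable {V : Type*} [AddCommGroup V] [Module ℂ V] {n : ℕ}

theorem IsRep.mem_of_forall_single {ι : Type*} [Fintype ι] [DecidableEq ι]
    {ρ : Matrix ι ι ℂ →ₗ[ℂ] End ℂ V} {N : Submodule ℂ V} {v : V}
    (h : ∀ i j, ρ (single i j 1) v ∈ N) (X : Matrix ι ι ℂ) : ρ X v ∈ N := by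
  rw [Matrix.matrix_eq_sum_single X]
  simp only [map_sum, LinearMap.sum_apply]
  refine Submodule.sum_mem _ fun i _ => Submodule.sum_mem _ fun j _ => ?_
  have : single i j (X i j) = X i j • single i j (1 : ℂ) := by simp
  rw [this, map_smul]
  exact N.smul_mem _ (h i j)

/-- The smallest subspace containing `w` and stable under strictly lower triangular matrices. -/
def lowerSpan (ρ : Matrix (Fin n) (Fin n) ℂ →ₗ[ℂ] End ℂ V) (w : V) : Submodule ℂ V :=
  sInf {W | w ∈ W ∧ ∀ i j, j < i → ∀ v ∈ W, ρ (single i j 1) v ∈ W}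

variable {ρ : Matrix (Fin n) (Fin n) ℂ →ₗ[ℂ] End ℂ V} {w : V}

theorem mem_lowerSpan : w ∈ lowerSpan ρ w := by
  simp only [lowerSpan, Submodule.mem_sInf]
  exact fun W hW => hW.1

theorem lowerSpan_le {W : Submodule ℂ V} (hw : w ∈ W)
    (hW : ∀ i j, j < i → ∀ v ∈ W, ρ (single i j 1) v ∈ W) : lowerSpan ρ w ≤ W :=
  sInf_le ⟨hw, hW⟩

theorem lower_mem_lowerSpan {i j : Fin n} (hij : j < i) {v : V} (hv : v ∈ lowerSpan ρ w) :
    ρ (single i j 1) v ∈ lowerSpan ρ w := by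
  simp only [lowerSpan, Submodule.mem_sInf] at hv ⊢
  exact fun W hW => hW.2 i j hij v (hv W hW)

theorem IsHighest.apply_mem_lowerSpan (hρ : IsRep ρ) {χ : Fin n → ℂ} (hw : IsHighest ρ χ w)
    (X : Matrix (Fin n) (Fin n) ℂ) {v : V} (hv : v ∈ lowerSpan ρ w) :
    ρ X v ∈ lowerSpan ρ w := by
  let S : Submodule ℂ V := lowerSpan ρ w ⊓ ⨅ (i : Fin n) (j : Fin n),
    (lowerSpan ρ w).comap (ρ (single i j 1))
  have hS : ∀ v, v ∈ S ↔ v ∈ lowerSpan ρ w ∧ ∀ i j, ρ (single i j 1) v ∈ lowerSpan ρ w := by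
    intro v; simp [S, Submodule.mem_iInf]
  have hle : lowerSpan ρ w ≤ S := by
    refine lowerSpan_le ?_ ?_
    · rw [hS]
      refine ⟨mem_lowerSpan, fun i j => ?_⟩
      rcases lt_trichotomy i j with h | rfl | h
      · rw [hw.upper i j h]; exact Submodule.zero_mem _
      · rw [hw.diag]; exact Submodule.smul_mem _ _ mem_lowerSpan
      · exact lower_mem_lowerSpan h mem_lowerSpan
    · intro k l hkl v hv
      rw [hS] at hv ⊢
      refine ⟨hv.2 k l, fun i j => ?_⟩
      rw [hρ.single_apply]
      refine Submodule.add_mem _ (lower_mem_lowerSpan hkl (hv.2 i j)) (Submodule.sub_mem _ ?_ ?_)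
      · split_ifs
        · exact hv.2 _ _
        · exact Submodule.zero_mem _
      · split_ifs
        · exact hv.2 _ _
        · exact Submodule.zero_mem _
  exact IsRep.mem_of_forall_single ((hS v).1 (hle hv)).2 X

theorem IsHighest.lowerSpan_le_eigenspaces (hρ : IsRep ρ) {χ : Fin n → ℂ}
    (hw : IsHighest ρ χ w) :
    lowerSpan ρ w ≤ Submodule.span ℂ {w} ⊔
      ⨆ m : ℕ, (ρ (Matrix.diagonal fun i : Fin n => -(i : ℂ))).eigenspace
        (∑ i : Fin n, -(i : ℂ) * χ i - (m + 1)) := by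
  set D := ρ (Matrix.diagonal fun i : Fin n => -(i : ℂ)) with hD
  set μ := ∑ i : Fin n, -(i : ℂ) * χ i
  have hle : ∀ m : ℕ, D.eigenspace (μ - (m + 1)) ≤
      Submodule.span ℂ {w} ⊔ ⨆ m : ℕ, D.eigenspace (μ - (m + 1)) := fun m =>
    (le_iSup (fun m : ℕ => D.eigenspace (μ - (m + 1))) m).trans le_sup_right
  have hwD : D w = μ • w := hw.diagonal _
  refine lowerSpan_le (Submodule.mem_sup_left (Submodule.mem_span_singleton_self w)) ?_
  intro i j hij v hv
  have hij' : (j : ℕ) < i := hij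
  have key : ∀ m : ℕ, ∀ u, D u = (μ - m) • u → ρ (single i j 1) u ∈
      Submodule.span ℂ {w} ⊔ ⨆ m : ℕ, D.eigenspace (μ - (m + 1)) := by
    intro m u hu
    refine hle (m + (i - j - 1)) ?_
    rw [Module.End.mem_eigenspace_iff]
    have := hρ.diagonal_shifts (fun i : Fin n => -(i : ℂ)) i j u
    rw [← hD, hu, map_smul, ← add_smul] at this
    rw [this]
    congr 1
    have h2 : ((i - j - 1 : ℕ) : ℂ) = i - j - 1 := by
      rw [Nat.cast_sub (by omega), Nat.cast_sub hij'.le]; simp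
    push_cast [h2]; ring
  refine (sup_le ?_ (iSup_le fun m => ?_) : _ ≤ Submodule.comap (ρ (single i j 1))
    (Submodule.span ℂ {w} ⊔ ⨆ m : ℕ, D.eigenspace (μ - (m + 1)))) hv
  · rw [Submodule.span_singleton_le_iff_mem]
    exact key 0 w (by simp [hwD])
  · intro u hu
    refine key (m + 1) u ?_
    rw [Module.End.mem_eigenspace_iff] at hu
    simpa using hu

/-- The direct sum of two representations. -/
def prodRep {T : Type*} [AddCommGroup T] [Module ℂ T] {ι : Type*}
    (ρ : Matrix ι ι ℂ →ₗ[ℂ] End ℂ V) (ρT : Matrix ι ι ℂ →ₗ[ℂ] End ℂ T) :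
    Matrix ι ι ℂ →ₗ[ℂ] End ℂ (V × T) where
  toFun X := (ρ X).prodMap (ρT X)
  map_add' X Y := by ext <;> simp
  map_smul' c X := by ext <;> simp

theorem IsHighest.exists_intertwiner {γ : Type*} [Fintype γ]
    {ρT : Matrix (Fin n) (Fin n) ℂ →ₗ[ℂ] End ℂ (γ → ℂ)} (hρ : IsRep ρ) (hρT : IsRep ρT)
    (hirr : ∀ W : Submodule ℂ V, (∀ X, ∀ v ∈ W, ρ X v ∈ W) → W = ⊥ ∨ W = ⊤)
    (hadj : ∀ X s t, star (ρT X s) ⬝ᵥ t = star s ⬝ᵥ ρT Xᴴ t)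
    {l : Fin n → ℕ} {v : V} {t : γ → ℂ} (hv0 : v ≠ 0) (hv : IsHighest ρ (fun i => (l i : ℂ)) v)
    (ht : IsHighest ρT (fun i => (l i : ℂ)) t) :
    ∃ φ : V →ₗ[ℂ] (γ → ℂ), φ v = t ∧ ∀ X u, φ (ρ X u) = ρT X (φ u) := by
  set P := prodRep ρ ρT with hP
  have hPapp : ∀ X s, P X s = (ρ X s.1, ρT X s.2) := fun X s => rfl
  have hPrep : IsRep P := by
    intro X Y s
    simp only [hPapp, Prod.mk_add_mk, hρ X Y s.1, hρT X Y s.2]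
  have hw : IsHighest P (fun i => (l i : ℂ)) (v, t) :=
    ⟨fun i j hij => by simp [hPapp, hv.upper i j hij, ht.upper i j hij],
     fun i => by simp [hPapp, hv.diag, ht.diag]⟩
  set N := lowerSpan P (v, t) with hN
  set μ := ∑ i : Fin n, -(i : ℂ) * (l i : ℂ) with hμ
  set Dm := Matrix.diagonal fun i : Fin n => -(i : ℂ) with hDm
  have hμr : star μ = μ := by simp [hμ]
  have hDmr : Dmᴴ = Dm := by
    rw [hDm, Matrix.diagonal_conjTranspose]; congr 1; ext i; simp
  have horth : ∀ q, ((0 : V), q) ∈ N → star q ⬝ᵥ t = 0 := by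
    intro q hq
    obtain ⟨a, ha, r, hr, har⟩ := Submodule.mem_sup.1 (hw.lowerSpan_le_eigenspaces hPrep hq)
    obtain ⟨c, rfl⟩ := Submodule.mem_span_singleton.1 ha
    have h1 : c • v + r.1 = 0 := congrArg Prod.fst har
    have h2 : c • t + r.2 = q := congrArg Prod.snd har
    have hr1 : r.1 ∈ ⨆ m : ℕ, (ρ Dm).eigenspace (μ - (m + 1)) := by
      have : (⨆ m : ℕ, (P Dm).eigenspace (μ - (m + 1))) ≤
          (⨆ m : ℕ, (ρ Dm).eigenspace (μ - (m + 1))).comap (LinearMap.fst ℂ V (γ → ℂ)) := by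
        refine iSup_le fun m s hs => ?_
        refine (le_iSup (fun m : ℕ => (ρ Dm).eigenspace (μ - (m + 1))) m) ?_
        rw [Module.End.mem_eigenspace_iff] at hs ⊢
        exact congrArg Prod.fst hs
      exact this hr
    have hr2 : star r.2 ⬝ᵥ t = 0 := by
      let O : Submodule ℂ (V × (γ → ℂ)) :=
        { carrier := {s | star s.2 ⬝ᵥ t = 0}
          add_mem' := fun {a b} ha hb => by
            simp only [Set.mem_ofPred_eq] at ha hb
            simp [ha, hb, add_dotProduct]
          zero_mem' := by simp
          smul_mem' := fun c a ha => by
            simp only [Set.mem_ofPred_eq] at ha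
            simp [smul_dotProduct, ha] }
      have : (⨆ m : ℕ, (P Dm).eigenspace (μ - (m + 1))) ≤ O := by
        refine iSup_le fun m s hs => ?_
        rw [Module.End.mem_eigenspace_iff] at hs
        have h3 : ρT Dm s.2 = (μ - (m + 1)) • s.2 := congrArg Prod.snd hs
        have h4 := hadj Dm s.2 t
        rw [hDmr, h3, ht.diagonal, ← hμ, star_smul, smul_dotProduct, dotProduct_smul] at h4
        have h5 : star (μ - ((m : ℂ) + 1)) = μ - (m + 1) := by
          rw [star_sub, hμr]; simp
        rw [h5, smul_eq_mul, smul_eq_mul] at h4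
        have h6 : ((m : ℂ) + 1) * (star s.2 ⬝ᵥ t) = 0 := by linear_combination -h4
        exact (mul_eq_zero.1 h6).resolve_left (by exact_mod_cast m.succ_ne_zero)
      exact this hr
    have hc : c = 0 := by
      by_contra hc
      have hdis := (Module.End.eigenspaces_iSupIndep (ρ Dm)) μ
      have hr1' : r.1 ∈ ⨆ j, ⨆ (_ : j ≠ μ), (ρ Dm).eigenspace j := by
        refine (iSup_le fun m : ℕ => ?_ : (⨆ m : ℕ, (ρ Dm).eigenspace (μ - (m + 1))) ≤ _) hr1
        refine le_iSup₂_of_le (μ - (m + 1)) ?_ le_rfl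
        simp only [ne_eq, sub_eq_self]
        exact_mod_cast m.succ_ne_zero
      have hcv : c • v ∈ (ρ Dm).eigenspace μ :=
        Submodule.smul_mem _ _ (Module.End.mem_eigenspace_iff.2 (hv.diagonal _))
      have hcv' : c • v = -r.1 := eq_neg_of_add_eq_zero_left h1
      have := Submodule.disjoint_def.1 hdis (c • v) hcv (hcv' ▸ Submodule.neg_mem _ hr1')
      exact (smul_ne_zero hc hv0) this
    rw [← h2, hc, zero_smul, zero_add, hr2]
  have hstab : ∀ X s, s ∈ N → P X s ∈ N := fun X s hs => hw.apply_mem_lowerSpan hPrep X hs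
  have hzero : ∀ q, ((0 : V), q) ∈ N → q = 0 := by
    intro q hq
    let K : Submodule ℂ (V × (γ → ℂ)) :=
        { carrier := {s | ∀ q, ((0 : V), q) ∈ N → star q ⬝ᵥ s.2 = 0}
          add_mem' := fun {a b} ha hb q hq => by
            simp [ha q hq, hb q hq, dotProduct_add]
          zero_mem' := by simp
          smul_mem' := fun c a ha q hq => by
            simp [dotProduct_smul, ha q hq] }
    have hNK : N ≤ K := by
      refine lowerSpan_le horth ?_
      intro i j _ s hs q hq
      rw [hPapp]
      dsimp only
      rw [← Matrix.conjTranspose_conjTranspose (single i j (1 : ℂ)), ← hadj]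
      refine hs _ ?_
      have := hstab (single i j (1 : ℂ))ᴴ _ hq
      rwa [hPapp, map_zero] at this
    open ComplexOrder in exact dotProduct_star_self_eq_zero.1 (hNK hq q hq)
  have hsurj : N.map (LinearMap.fst ℂ V (γ → ℂ)) = ⊤ := by
    refine (hirr _ ?_).resolve_left ?_
    · rintro X _ ⟨s, hs, rfl⟩
      exact ⟨P X s, hstab X s hs, rfl⟩
    · intro h
      refine hv0 ((Submodule.mem_bot ℂ).1 (h ▸ ⟨(v, t), mem_lowerSpan, rfl⟩))
  let g : N →ₗ[ℂ] V := LinearMap.fst ℂ V (γ → ℂ) ∘ₗ N.subtype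
  have hg : Function.Bijective g := by
    constructor
    · rw [← LinearMap.ker_eq_bot, Submodule.eq_bot_iff]
      rintro ⟨⟨a, q⟩, hs⟩ h0
      obtain rfl : a = 0 := h0
      obtain rfl := hzero q hs
      rfl
    · intro u
      obtain ⟨s, hs, hs'⟩ := (hsurj ▸ Submodule.mem_top : u ∈ N.map (LinearMap.fst ℂ V (γ → ℂ)))
      exact ⟨⟨s, hs⟩, hs'⟩
  let G := LinearEquiv.ofBijective g hg
  have hGs : ∀ s : N, G.symm s.1.1 = s := fun s => G.symm_apply_apply s
  refine ⟨LinearMap.snd ℂ V (γ → ℂ) ∘ₗ N.subtype ∘ₗ G.symm.toLinearMap, ?_, fun X u => ?_⟩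
  · have := hGs ⟨(v, t), mem_lowerSpan⟩
    simp only [LinearMap.comp_apply, LinearEquiv.coe_coe]
    dsimp only at this
    rw [this]; rfl
  · obtain ⟨s, rfl⟩ := hg.2 u
    have h1 : G.symm (g s) = s := hGs s
    have h2 := hGs ⟨P X s, hstab X s s.2⟩
    have h3 : ρ X (g s) = (P X s).1 := rfl
    simp only [LinearMap.comp_apply, LinearEquiv.coe_coe, h1, h3]
    dsimp only at h2
    rw [h2]; rfl

end Intertwiner

section Tensor

variable {B ι : Type*} [Fintype B] [DecidableEq B] [Fintype ι] [DecidableEq ι]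

/-- The matrix `X` acting on the tensor factor `b` of `(ℂ^ι)^{⊗ B}`. -/
def slotRep (b : B) : Matrix ι ι ℂ →ₗ[ℂ] End ℂ ((B → ι) → ℂ) where
  toFun X :=
    { toFun := fun t c => ∑ a, X (c b) a * t (Function.update c b a)
      map_add' := fun s t => by ext c; simp [mul_add, Finset.sum_add_distrib]
      map_smul' := fun k t => by ext c; simp [Finset.mul_sum, mul_left_comm] }
  map_add' X Y := by ext1 t; ext c; simp [add_mul, Finset.sum_add_distrib]
  map_smul' k X := by ext1 t; ext c; simp [Finset.mul_sum, mul_assoc]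

theorem slotRep_apply (b : B) (X : Matrix ι ι ℂ) (t : (B → ι) → ℂ) (c : B → ι) :
    slotRep b X t c = ∑ a, X (c b) a * t (Function.update c b a) := rfl

/-- The representation of matrices on `(ℂ^ι)^{⊗ B}`. -/
def tensorRep (B ι : Type*) [Fintype B] [DecidableEq B] [Fintype ι] [DecidableEq ι] :
    Matrix ι ι ℂ →ₗ[ℂ] End ℂ ((B → ι) → ℂ) := ∑ b : B, slotRep b

theorem tensorRep_apply (X : Matrix ι ι ℂ) (t : (B → ι) → ℂ) :
    tensorRep B ι X t = ∑ b, slotRep b X t := by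
  simp [tensorRep]

theorem tensorRep_apply_apply (X : Matrix ι ι ℂ) (t : (B → ι) → ℂ) (c : B → ι) :
    tensorRep B ι X t c = ∑ b, ∑ a, X (c b) a * t (Function.update c b a) := by
  simp [tensorRep_apply, slotRep_apply]

theorem slotRep_mul (b : B) (X Y : Matrix ι ι ℂ) (t : (B → ι) → ℂ) :
    slotRep b X (slotRep b Y t) = slotRep b (X * Y) t := by
  ext c
  simp only [slotRep_apply, Function.update_self, Function.update_idem, Matrix.mul_apply,
    Finset.mul_sum, Finset.sum_mul, mul_assoc]
  exact Finset.sum_comm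

theorem slotRep_comm {b b' : B} (h : b ≠ b') (X Y : Matrix ι ι ℂ) (t : (B → ι) → ℂ) :
    slotRep b X (slotRep b' Y t) = slotRep b' Y (slotRep b X t) := by
  ext c
  simp only [slotRep_apply, Finset.mul_sum]
  rw [Finset.sum_comm]
  refine Finset.sum_congr rfl fun a _ => Finset.sum_congr rfl fun a' _ => ?_
  rw [Function.update_of_ne h.symm, Function.update_of_ne h, Function.update_comm h]
  ring

theorem isRep_tensorRep : IsRep (tensorRep B ι) := by
  intro X Y t
  simp only [tensorRep_apply, map_sum, map_sub, LinearMap.sub_apply, ← slotRep_mul]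
  rw [Finset.sum_comm (f := fun b b' => slotRep b' Y (slotRep b X t)), ← Finset.sum_sub_distrib,
    ← Finset.sum_add_distrib]
  refine Finset.sum_congr rfl fun b _ => ?_
  have h : ∀ b', slotRep b' X (slotRep b Y t) = slotRep b Y (slotRep b' X t) +
      if b' = b then slotRep b X (slotRep b Y t) - slotRep b Y (slotRep b X t) else 0 := by
    intro b'
    split_ifs with hb
    · subst hb; abel
    · rw [slotRep_comm hb, add_zero]
  rw [Finset.sum_congr rfl fun b' _ => h b', Finset.sum_add_distrib, Finset.sum_ite_eq',
    if_pos (Finset.mem_univ b)]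

theorem dotProduct_slotRep (b : B) (X : Matrix ι ι ℂ) (s t : (B → ι) → ℂ) :
    s ⬝ᵥ slotRep b X t = slotRep b Xᵀ s ⬝ᵥ t := by
  simp only [dotProduct, slotRep_apply, Finset.mul_sum, Finset.sum_mul]
  rw [← Fintype.sum_prod_type', ← Fintype.sum_prod_type']
  let Φ : (B → ι) × ι → (B → ι) × ι := fun p => (Function.update p.1 b p.2, p.1 b)
  have hΦ : Function.Involutive Φ := by
    rintro ⟨c, a⟩
    simp [Φ]
  rw [← Equiv.sum_comp (hΦ.toPerm Φ)]
  refine Finset.sum_congr rfl fun p _ => ?_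
  simp [Φ]
  ring

theorem dotProduct_tensorRep (X : Matrix ι ι ℂ) (s t : (B → ι) → ℂ) :
    s ⬝ᵥ tensorRep B ι X t = tensorRep B ι Xᵀ s ⬝ᵥ t := by
  simp only [tensorRep_apply, dotProduct_sum, sum_dotProduct, dotProduct_slotRep]

theorem star_tensorRep_dotProduct (X : Matrix ι ι ℂ) (s t : (B → ι) → ℂ) :
    star (tensorRep B ι X s) ⬝ᵥ t = star s ⬝ᵥ tensorRep B ι Xᴴ t := by
  rw [dotProduct_tensorRep]
  congr 1
  ext c
  simp [tensorRep_apply_apply, Matrix.conjTranspose]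

theorem slotRep_single (b : B) (X : Matrix ι ι ℂ) (r : B → ι) :
    slotRep b X (Pi.single r 1) = ∑ a, X a (r b) • Pi.single (Function.update r b a) (1 : ℂ) := by
  ext c
  simp only [slotRep_apply, Finset.sum_apply, Pi.smul_apply, Pi.single_apply, smul_eq_mul]
  by_cases h : ∀ b', b' ≠ b → c b' = r b'
  · have h1 : ∀ a, Function.update c b a = r ↔ a = r b := by
      intro a
      rw [Function.update_eq_iff]
      exact ⟨fun h => h.1, fun h' => ⟨h', h⟩⟩
    have h2 : ∀ a, c = Function.update r b a ↔ a = c b := by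
      intro a
      rw [Function.eq_update_iff]
      exact ⟨fun h => h.1.symm, fun h' => ⟨h'.symm, h⟩⟩
    simp [h1, h2]
  · have h1 : ∀ a, Function.update c b a ≠ r := by
      intro a ha
      rw [Function.update_eq_iff] at ha
      exact h ha.2
    have h2 : ∀ a, c ≠ Function.update r b a := by
      intro a ha
      rw [Function.eq_update_iff] at ha
      exact h ha.2
    simp [h1, h2]

variable {γ : Type*} [DecidableEq γ]

/-- Permutations of boxes preserving columns. -/
def colPerm (col : B → γ) : Finset (Equiv.Perm B) :=
  Finset.univ.filter fun σ => ∀ b, col (σ b) = col b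

/-- The antisymmetrization along columns of a basis tensor. -/
def colAlt (col : B → γ) (r : B → ι) : (B → ι) → ℂ :=
  ∑ σ ∈ colPerm col, ((Equiv.Perm.sign σ : ℤ) : ℂ) • Pi.single (r ∘ σ) 1

theorem dotProduct_colAlt (col : B → γ) (r : B → ι) (Z : (B → ι) → ℂ) :
    Z ⬝ᵥ colAlt col r = ∑ σ ∈ colPerm col, ((Equiv.Perm.sign σ : ℤ) : ℂ) * Z (r ∘ σ) := by
  simp [colAlt, dotProduct_sum, dotProduct_smul]

theorem tensorRep_colAlt (col : B → γ) (r : B → ι) (X : Matrix ι ι ℂ) :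
    tensorRep B ι X (colAlt col r) =
      ∑ y, ∑ a, X a (r y) • colAlt col (Function.update r y a) := by
  have h1 : ∀ σ : Equiv.Perm B, tensorRep B ι X (Pi.single (r ∘ σ) 1) =
      ∑ y, ∑ a, X a (r y) • Pi.single (Function.update r y a ∘ σ) (1 : ℂ) := by
    intro σ
    rw [tensorRep_apply, ← Equiv.sum_comp σ (fun y => ∑ a, X a (r y) • _)]
    refine Finset.sum_congr rfl fun b _ => ?_
    rw [slotRep_single]
    refine Finset.sum_congr rfl fun a _ => ?_
    rw [Function.comp_apply, Function.update_comp_eq_of_injective _ σ.injective]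
  simp only [colAlt, map_sum, map_smul, h1, Finset.smul_sum]
  rw [Finset.sum_comm]
  refine Finset.sum_congr rfl fun y _ => ?_
  rw [Finset.sum_comm]
  refine Finset.sum_congr rfl fun a _ => Finset.sum_congr rfl fun σ _ => ?_
  rw [smul_comm]

theorem colAlt_eq_zero {col : B → γ} {r : B → ι} {y y' : B} (hne : y ≠ y')
    (hcol : col y = col y') (hr : r y = r y') : colAlt col r = 0 := by
  have hsw : ∀ x, r (Equiv.swap y y' x) = r x := by
    intro x
    rw [Equiv.swap_apply_def]
    split_ifs with h1 h2 <;> simp [*]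
  have hswc : ∀ x, col (Equiv.swap y y' x) = col x := by
    intro x
    rw [Equiv.swap_apply_def]
    split_ifs with h1 h2 <;> simp [*]
  refine Finset.sum_involution (fun σ _ => Equiv.swap y y' * σ) ?_ ?_ ?_ ?_
  · intro σ _
    have : r ∘ (Equiv.swap y y' * σ : Equiv.Perm B) = r ∘ σ := by
      ext x; simp [hsw]
    rw [this, Equiv.Perm.sign_mul, Equiv.Perm.sign_swap hne]
    simp
  · intro σ _ _ h
    rw [mul_eq_right] at h
    exact hne (by simpa using congrArg (fun p : Equiv.Perm B => p y') h)
  · intro σ hσ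
    simp only [colPerm, Finset.mem_filter, Finset.mem_univ, true_and] at hσ ⊢
    intro b
    rw [Equiv.Perm.mul_apply, hswc, hσ]
  · intro σ _
    rw [← mul_assoc, Equiv.swap_mul_self, one_mul]

variable {n : ℕ}

theorem isHighest_colAlt {col : B → γ} {row : B → Fin n}
    (hclosed : ∀ b, ∀ i < row b, ∃ b', col b' = col b ∧ row b' = i) :
    IsHighest (tensorRep B (Fin n)) (fun i => ((Finset.univ.filter fun b => row b = i).card : ℂ))
      (colAlt col row) where
  upper i j hij := by
    rw [tensorRep_colAlt]
    refine Finset.sum_eq_zero fun y _ => Finset.sum_eq_zero fun a _ => ?_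
    by_cases h : i = a ∧ j = row y
    · obtain ⟨rfl, rfl⟩ := h
      obtain ⟨y', hy', rfl⟩ := hclosed y i hij
      have hne : y ≠ y' := by rintro rfl; exact lt_irrefl _ hij
      rw [colAlt_eq_zero hne hy'.symm (by simp [hne.symm]), smul_zero]
    · rw [Matrix.single_apply, if_neg h, zero_smul]
  diag i := by
    rw [tensorRep_colAlt]
    simp only [Matrix.single_apply, ite_and, ite_smul, one_smul, zero_smul, Finset.sum_ite_eq,
      Finset.mem_univ, if_true]
    rw [← Finset.sum_filter]
    have : ∀ y ∈ Finset.univ.filter (fun b => i = row b),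
        colAlt col (Function.update row y i) = colAlt col row := by
      intro y hy
      rw [(Finset.mem_filter.1 hy).2, Function.update_eq_self]
    rw [Finset.sum_congr rfl this, Finset.sum_const]
    simp [eq_comm, Nat.cast_smul_eq_nsmul]

/-- Tensors give functionals on the irreducible representation of highest weight `l`. -/
theorem IsHighest.exists_functional {V : Type*} [AddCommGroup V] [Module ℂ V]
    {ρ : Matrix (Fin n) (Fin n) ℂ →ₗ[ℂ] End ℂ V} (hρ : IsRep ρ)
    (hirr : ∀ W : Submodule ℂ V, (∀ X, ∀ v ∈ W, ρ X v ∈ W) → W = ⊥ ∨ W = ⊤)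
    {l : Fin n → ℕ} {v : V} (hv0 : v ≠ 0) (hv : IsHighest ρ (fun i => (l i : ℂ)) v)
    {col : B → γ} {row : B → Fin n}
    (hclosed : ∀ b, ∀ i < row b, ∃ b', col b' = col b ∧ row b' = i)
    (hcard : ∀ i, (Finset.univ.filter fun b => row b = i).card = l i) :
    ∃ ξ : ((B → Fin n) → ℂ) →ₗ[ℂ] V →ₗ[ℂ] ℂ,
      (∀ Z X u, ξ Z (ρ X u) = ξ (tensorRep B (Fin n) Xᵀ Z) u) ∧
      ∀ Z, ξ Z v = ∑ σ ∈ colPerm col, ((Equiv.Perm.sign σ : ℤ) : ℂ) * Z (row ∘ σ) := by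
  obtain ⟨φ, hφv, hφ⟩ := hv.exists_intertwiner (γ := B → Fin n) hρ isRep_tensorRep hirr
    star_tensorRep_dotProduct hv0 (t := colAlt col row)
    (by simpa only [hcard] using isHighest_colAlt hclosed)
  refine ⟨LinearMap.mk₂ ℂ (fun Z u => Z ⬝ᵥ φ u) ?_ ?_ ?_ ?_, ?_, ?_⟩
  · intro a b u; exact add_dotProduct _ _ _
  · intro c a u; exact smul_dotProduct _ _ _
  · intro a u w; rw [map_add, dotProduct_add]
  · intro c a u; rw [map_smul, dotProduct_smul]
  · intro Z X u
    rw [LinearMap.mk₂_apply, LinearMap.mk₂_apply, hφ, dotProduct_tensorRep]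
  · intro Z
    rw [LinearMap.mk₂_apply, hφv, dotProduct_colAlt]

end Tensor

section Core

variable {B : Type*} [Fintype B] [DecidableEq B] {n : ℕ}

/-- `row` and `col` are the coordinates of the boxes of the Young diagram with row lengths `l`. -/
structure IsFilling (row : B → Fin n) (col : B → ℕ) (l : Fin n → ℕ) : Prop where
  inj : ∀ b b', row b = row b' → col b = col b' → b = b'
  lt : ∀ b, col b < l (row b)
  surj : ∀ i k, k < l i → ∃ b, row b = i ∧ col b = k

theorem IsFilling.card_eq {row : B → Fin n} {col : B → ℕ} {l : Fin n → ℕ}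
    (h : IsFilling row col l) (i : Fin n) :
    (Finset.univ.filter fun b => row b = i).card = l i := by
  rw [← Finset.card_range (l i)]
  refine Finset.card_nbij col ?_ ?_ ?_
  · intro b hb
    have := (Finset.mem_filter.1 hb).2
    simpa [← this] using h.lt b
  · intro b hb b' hb' hbb
    simp only [Finset.coe_filter, Finset.mem_univ, true_and, Set.mem_ofPred_eq] at hb hb'
    exact h.inj b b' (hb.trans hb'.symm) hbb
  · intro k hk
    obtain ⟨b, hb, hb'⟩ := h.surj i k (by simpa using hk)
    exact ⟨b, by simpa using hb, hb'⟩

theorem IsFilling.closed {row : B → Fin n} {col : B → ℕ} {l : Fin n → ℕ}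
    (h : IsFilling row col l) (hl : Antitone l) (b : B) (i : Fin n) (hi : i < row b) :
    ∃ b', col b' = col b ∧ row b' = i := by
  obtain ⟨b', h1, h2⟩ := h.surj i (col b) ((h.lt b).trans_le (hl hi.le))
  exact ⟨b', h2, h1⟩

theorem exists_lowestWeight_of_tensor {V : Type*} [AddCommGroup V] [Module ℂ V]
    [FiniteDimensional ℂ V] {ρ : Matrix (Fin n) (Fin n) ℂ →ₗ[ℂ] End ℂ V} (hρ : IsRep ρ)
    (hirr : ∀ W : Submodule ℂ V, (∀ X, ∀ v ∈ W, ρ X v ∈ W) → W = ⊥ ∨ W = ⊤)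
    {H E F : Matrix (Fin n) (Fin n) ℂ} (t : IsSl2 (ρ H) (ρ E) (ρ F))
    {l : Fin n → ℕ} (hl : Antitone l) {v : V} (hv0 : v ≠ 0)
    (hv : IsHighest ρ (fun i => (l i : ℂ)) v)
    {row : B → Fin n} {col : B → ℕ} (hfill : IsFilling row col l) (Z : (B → Fin n) → ℂ) (m q : ℕ)
    (hH : tensorRep B (Fin n) Hᵀ Z = (-m : ℂ) • Z) (hE : (tensorRep B (Fin n) Eᵀ ^ q) Z = 0)
    (hZ : Z row ≠ 0)
    (hσ : ∀ σ : Equiv.Perm B, (∀ b, col (σ b) = col b) → Z (row ∘ σ) ≠ 0 →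
      ((Equiv.Perm.sign σ : ℤ) : ℂ) * Z (row ∘ σ) = Z row) :
    ∃ i < q, ∃ u, u ≠ 0 ∧ ρ H u = (-(m + 2 * i : ℕ) : ℂ) • u ∧ ρ F u = 0 := by
  obtain ⟨ξ, hξ, hξv⟩ := hv.exists_functional hρ hirr hv0 (hfill.closed hl) hfill.card_eq
  refine exists_lowestWeight_of_functional_pow t (ξ Z) ?_ m q ?_ ?_
  · intro h0
    have h1 : ∑ σ ∈ colPerm col, ((Equiv.Perm.sign σ : ℤ) : ℂ) * Z (row ∘ σ) =
        ∑ σ ∈ colPerm col, if Z (row ∘ σ) ≠ 0 then Z row else 0 := by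
      refine Finset.sum_congr rfl fun σ hs => ?_
      split_ifs with h
      · exact hσ σ (Finset.mem_filter.1 hs).2 h
      · rw [not_not.1 h, mul_zero]
    rw [← Finset.sum_filter, Finset.sum_const, ← hξv, h0, LinearMap.zero_apply, eq_comm,
      nsmul_eq_mul, mul_eq_zero, Nat.cast_eq_zero, Finset.card_eq_zero] at h1
    have h2 : (1 : Equiv.Perm B) ∈ (colPerm col).filter fun σ : Equiv.Perm B => Z (row ∘ σ) ≠ 0 := by
      simpa [colPerm] using hZ
    rw [h1.resolve_right hZ] at h2
    simp at h2
  · intro u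
    rw [hξ, hH, map_smul]; simp
  · suffices ∀ Z, ∀ u, ξ Z ((ρ E ^ q) u) = ξ ((tensorRep B (Fin n) Eᵀ ^ q) Z) u by
      intro u; rw [this, hE, map_zero, LinearMap.zero_apply]
    clear hE
    induction q with
    | zero => simp
    | succ q ih =>
      intro Z u
      rw [pow_succ', Module.End.mul_apply, hξ, ih, pow_succ, Module.End.mul_apply]

end Core

section PairSign

variable {P L : Type*} [Fintype P] [DecidableEq P] [Fintype L] [DecidableEq L]

/-- A permutation preserving pairs acts on a product of weights of pairs through its sign. -/
theorem sign_mul_prod_pairs (σ : Equiv.Perm (P × Fin 2 ⊕ L)) (hL : ∀ x, σ (.inr x) = .inr x)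
    (w : P → P × Fin 2 ⊕ L → P × Fin 2 ⊕ L → ℂ)
    (hσ : ∀ i, ∃ j, (σ (.inl (i, 0)) = .inl (j, 0) ∧ σ (.inl (i, 1)) = .inl (j, 1) ∧
        w i (.inl (j, 0)) (.inl (j, 1)) = w j (.inl (j, 0)) (.inl (j, 1))) ∨
      (σ (.inl (i, 0)) = .inl (j, 1) ∧ σ (.inl (i, 1)) = .inl (j, 0) ∧
        w i (.inl (j, 1)) (.inl (j, 0)) = -w j (.inl (j, 0)) (.inl (j, 1)))) :
    ((Equiv.Perm.sign σ : ℤ) : ℂ) * ∏ i, w i (σ (.inl (i, 0))) (σ (.inl (i, 1))) =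
      ∏ i, w i (.inl (i, 0)) (.inl (i, 1)) := by
  classical
  choose τ hτ using hσ
  have hinj : Function.Injective τ := by
    intro i i' h
    have : ∃ k k' : Fin 2, σ (.inl (i, k)) = σ (.inl (i', k')) := by
      rcases hτ i with h1 | h1 <;> rcases hτ i' with h2 | h2
      · exact ⟨0, 0, by rw [h1.1, h2.1, h]⟩
      · exact ⟨0, 1, by rw [h1.1, h2.2.1, h]⟩
      · exact ⟨0, 1, by rw [h1.1, h2.2.1, h]⟩
      · exact ⟨0, 0, by rw [h1.1, h2.1, h]⟩
    obtain ⟨k, k', hk⟩ := this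
    have := σ.injective hk
    simp only [Sum.inl.injEq, Prod.mk.injEq] at this
    exact this.1
  let τ' : Equiv.Perm P := Equiv.ofBijective τ (Finite.injective_iff_bijective.1 hinj)
  let s : P → Equiv.Perm (Fin 2) := fun i =>
    if σ (.inl (i, 0)) = .inl (τ i, 0) then 1 else Equiv.swap 0 1
  have hσeq : σ = Equiv.Perm.sumCongr
      ((Equiv.prodCongrLeft fun _ => τ') * Equiv.prodCongrRight s : Equiv.Perm (P × Fin 2)) 1 := by
    ext1 x
    rcases x with ⟨i, k⟩ | x
    · rcases hτ i with h1 | h1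
      · have hs : s i = 1 := if_pos h1.1
        fin_cases k
        · simpa [hs, τ'] using h1.1
        · simpa [hs, τ'] using h1.2.1
      · have hs : s i = Equiv.swap 0 1 := if_neg (by simp [h1.1])
        fin_cases k
        · simpa [hs, τ'] using h1.1
        · simpa [hs, τ'] using h1.2.1
    · simp [hL]
  have hsign : Equiv.Perm.sign σ = ∏ i, Equiv.Perm.sign (s i) := by
    rw [hσeq, Equiv.Perm.sign_sumCongr, Equiv.Perm.sign_mul, Equiv.Perm.sign_prodCongrLeft,
      Equiv.Perm.sign_prodCongrRight]
    simp
  have hprod : ∏ i, w i (.inl (i, 0)) (.inl (i, 1)) =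
      ∏ i, w (τ i) (.inl (τ i, 0)) (.inl (τ i, 1)) :=
    (Equiv.prod_comp τ' fun i => w i (.inl (i, 0)) (.inl (i, 1))).symm
  rw [hsign, hprod]
  push_cast
  rw [← Finset.prod_mul_distrib]
  refine Finset.prod_congr rfl fun i _ => ?_
  rcases hτ i with h1 | h1
  · have hs : s i = 1 := if_pos h1.1
    rw [hs, h1.1, h1.2.1, h1.2.2]; simp
  · have hs : s i = Equiv.swap 0 1 := if_neg (by simp [h1.1])
    rw [hs, h1.1, h1.2.1, h1.2.2]; simp

end PairSign

section Leibniz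

variable {B ι : Type*} [Fintype B] [DecidableEq B] [Fintype ι] [DecidableEq ι]

theorem slotRep_mul_of_indep (b : B) (Y : Matrix ι ι ℂ) (f g : (B → ι) → ℂ)
    (hg : ∀ c a, g (Function.update c b a) = g c) :
    slotRep b Y (fun c => f c * g c) = fun c => slotRep b Y f c * g c := by
  ext c
  simp only [slotRep_apply, hg, Finset.sum_mul, mul_assoc]

theorem slotRep_covector (b : B) (Y : Matrix ι ι ℂ) (w : ι → ℂ) :
    slotRep b Y (fun c => w (c b)) = fun c => (Y *ᵥ w) (c b) := by
  ext c; simp [slotRep_apply, Matrix.mulVec, dotProduct]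

theorem slotRep_pair_left {b b' : B} (h : b ≠ b') (Y M : Matrix ι ι ℂ) :
    slotRep b Y (fun c => M (c b) (c b')) = fun c => (Y * M) (c b) (c b') := by
  ext c; simp [slotRep_apply, Matrix.mul_apply, h.symm]

theorem slotRep_pair_right {b b' : B} (h : b ≠ b') (Y M : Matrix ι ι ℂ) :
    slotRep b' Y (fun c => M (c b) (c b')) = fun c => (M * Yᵀ) (c b) (c b') := by
  ext c; simp [slotRep_apply, Matrix.mul_apply, h, mul_comm]

end Leibniz

section Block

variable {P K L ι : Type*} [Fintype P] [DecidableEq P] [Fintype K] [DecidableEq K]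
  [Fintype L] [DecidableEq L] [Fintype ι] [DecidableEq ι]

/-- The tensor product of the tensors `G x`, with factors indexed by `{x} × K`, and of `τ`. -/
def blockTensor (G : P → (K → ι) → ℂ) (τ : (L → ι) → ℂ) : (P × K ⊕ L → ι) → ℂ :=
  fun c => (∏ x, G x fun k => c (.inl (x, k))) * τ fun y => c (.inr y)

theorem tensorRep_blockTensor (Y : Matrix ι ι ℂ) (G : P → (K → ι) → ℂ) (τ : (L → ι) → ℂ) :
    tensorRep (P × K ⊕ L) ι Y (blockTensor G τ) =
      ∑ x, blockTensor (Function.update G x (tensorRep K ι Y (G x))) τ +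
        blockTensor G (tensorRep L ι Y τ) := by
  ext c
  simp only [tensorRep_apply, Finset.sum_apply, Pi.add_apply, Fintype.sum_sum_type,
    Fintype.sum_prod_type]
  congr 1
  · refine Finset.sum_congr rfl fun x _ => ?_
    have hupd : ∀ x' ∈ ({x}ᶜ : Finset P), ∀ k a, (fun k' => Function.update c
        (.inl (x, k)) a (.inl (x', k'))) = fun k' => c (.inl (x', k')) := by
      intro x' hx' k a
      ext k'
      rw [Function.update_of_ne]
      simp only [Finset.mem_compl, Finset.mem_singleton] at hx'
      simp [hx']
    have hupd' : ∀ k a, (fun k' => Function.update c (.inl (x, k)) a (.inl (x, k'))) =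
        Function.update (fun k' => c (.inl (x, k'))) k a := by
      intro k a
      ext k'
      by_cases h : k' = k
      · subst h; simp
      · simp [Function.update_of_ne, h]
    simp only [blockTensor, slotRep_apply, Fintype.prod_eq_mul_prod_compl x, hupd',
      Function.update_self, Finset.sum_apply, Finset.sum_mul]
    refine Finset.sum_congr rfl fun k _ => Finset.sum_congr rfl fun a _ => ?_
    rw [Finset.prod_congr rfl fun x' hx' => by rw [hupd x' hx']]
    rw [Finset.prod_congr (f := fun x' => Function.update G x _ x' _) rfl fun x' hx' => by
      rw [Function.update_of_ne (by simpa using hx')]]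
    simp [mul_assoc]
  · simp only [blockTensor, slotRep_apply, Finset.sum_apply, Finset.mul_sum]
    refine Finset.sum_congr rfl fun y _ => Finset.sum_congr rfl fun a _ => ?_
    have hupd : (fun y' => Function.update c (.inr y) a (.inr y')) =
        Function.update (fun y' => c (.inr y')) y a := by
      ext y'
      by_cases h : y' = y
      · subst h; simp
      · simp [Function.update_of_ne, h]
    rw [hupd]
    simp
    ring

theorem blockTensor_update_zero (G : P → (K → ι) → ℂ) (τ : (L → ι) → ℂ) (x : P) :
    blockTensor (Function.update G x 0) τ = 0 := by
  ext c
  simp [blockTensor, Fintype.prod_eq_mul_prod_compl x]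

theorem blockTensor_smul (G : P → (K → ι) → ℂ) (τ : (L → ι) → ℂ) (μ : ℂ) :
    blockTensor G (μ • τ) = μ • blockTensor G τ := by
  ext c
  simp [blockTensor, mul_left_comm]

theorem tensorRep_blockTensor_of_eq_zero (Y : Matrix ι ι ℂ) (G : P → (K → ι) → ℂ)
    (τ : (L → ι) → ℂ) (hG : ∀ x, tensorRep K ι Y (G x) = 0) :
    tensorRep (P × K ⊕ L) ι Y (blockTensor G τ) = blockTensor G (tensorRep L ι Y τ) := by
  simp [tensorRep_blockTensor, hG, blockTensor_update_zero]

theorem tensorRep_pow_blockTensor_of_eq_zero (Y : Matrix ι ι ℂ) (G : P → (K → ι) → ℂ)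
    (τ : (L → ι) → ℂ) (hG : ∀ x, tensorRep K ι Y (G x) = 0) (q : ℕ) :
    (tensorRep (P × K ⊕ L) ι Y ^ q) (blockTensor G τ) =
      blockTensor G ((tensorRep L ι Y ^ q) τ) := by
  induction q with
  | zero => rfl
  | succ q ih =>
    rw [pow_succ', Module.End.mul_apply, ih, tensorRep_blockTensor_of_eq_zero _ _ _ hG,
      pow_succ', Module.End.mul_apply]

/-- The bilinear form with matrix `M` as a tensor. -/
def formTensor (M : Matrix ι ι ℂ) : (Fin 2 → ι) → ℂ := fun c => M (c 0) (c 1)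

theorem tensorRep_formTensor (X M : Matrix ι ι ℂ) :
    tensorRep (Fin 2) ι Xᵀ (formTensor M) = formTensor (Xᵀ * M + M * X) := by
  have h0 := slotRep_pair_left (B := Fin 2) zero_ne_one Xᵀ M
  have h1 := slotRep_pair_right (B := Fin 2) zero_ne_one Xᵀ M
  rw [tensorRep_apply, Fin.sum_univ_two]
  unfold formTensor
  rw [h0, h1]
  ext c
  simp

end Block

section OddCase

variable {ι : Type*} [Fintype ι] [DecidableEq ι] {Q : Type*} [Fintype Q] [DecidableEq Q]
  {p : ℕ}

/-- A product of copies of `J`, of `S`, and of `T` (the latter at the positions in `A`). -/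
def mixedTensor (Q : Type*) [Fintype Q] (J S T : Matrix ι ι ℂ) (A : Finset (Fin p)) :
    ((Q ⊕ Fin p) × Fin 2 ⊕ Fin 0 → ι) → ℂ :=
  blockTensor (Sum.elim (fun _ => formTensor J)
    fun i => formTensor (if i ∈ A then T else S)) fun _ => 1

theorem tensorRep_mixedTensor {X J S T : Matrix ι ι ℂ} (hJ : Xᵀ * J + J * X = 0)
    (hS : Xᵀ * S + S * X = (2 : ℂ) • T) (hT : Xᵀ * T + T * X = 0) (A : Finset (Fin p)) :
    tensorRep _ ι Xᵀ (mixedTensor Q J S T A) =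
      ∑ i ∈ Aᶜ, (2 : ℂ) • mixedTensor Q J S T (insert i A) := by
  have h0 : formTensor (0 : Matrix ι ι ℂ) = 0 := rfl
  have h1 : tensorRep (Fin 0) ι Xᵀ (fun _ => 1) = 0 := by simp [tensorRep]
  have h2 : ∀ G : Q ⊕ Fin p → (Fin 2 → ι) → ℂ,
      blockTensor G (0 : (Fin 0 → ι) → ℂ) = 0 := by
    intro G; ext c; simp [blockTensor]
  rw [mixedTensor, tensorRep_blockTensor, h1, h2, add_zero, Fintype.sum_sum_type]
  rw [Finset.sum_eq_zero, zero_add, ← Finset.sum_filter_add_sum_filter_not _ (fun i => i ∈ A),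
    Finset.sum_eq_zero, zero_add]
  · refine Finset.sum_congr (by ext; simp) fun i hi => ?_
    have hi : i ∉ A := by simpa using hi
    rw [Sum.elim_inr, if_neg hi, tensorRep_formTensor, hS]
    ext c
    have hne : ∀ j ∈ ({i}ᶜ : Finset (Fin p)), (j ∈ insert i A) = (j ∈ A) := by
      intro j hj
      simp only [Finset.mem_compl, Finset.mem_singleton] at hj
      simp [hj]
    simp only [mixedTensor, blockTensor, Pi.smul_apply, smul_eq_mul, Fintype.prod_sum_type,
      Sum.elim_inl, Sum.elim_inr, Fintype.prod_eq_mul_prod_compl i, Function.update_self,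
      Finset.mem_insert_self, if_true]
    rw [Finset.prod_congr (s₁ := {i}ᶜ) rfl fun j hj => by
      rw [Function.update_of_ne (by simpa using hj)]]
    simp only [Sum.elim_inr]
    rw [Finset.prod_congr (s₁ := {i}ᶜ) (f := fun x => formTensor (if x ∈ insert i A then T else S) _)
      rfl fun j hj => by rw [if_congr (hne j hj).to_iff rfl rfl]]
    simp [formTensor]
    ring
  · intro i hi
    have hi : i ∈ A := (Finset.mem_filter.1 hi).2
    rw [Sum.elim_inr, if_pos hi, tensorRep_formTensor, hT, h0, blockTensor_update_zero]
  · intro x _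
    rw [Sum.elim_inl, tensorRep_formTensor, hJ, h0, blockTensor_update_zero]

theorem tensorRep_pow_mixedTensor {X J S T : Matrix ι ι ℂ} (hJ : Xᵀ * J + J * X = 0)
    (hS : Xᵀ * S + S * X = (2 : ℂ) • T) (hT : Xᵀ * T + T * X = 0) (k : ℕ) (A : Finset (Fin p))
    (hk : p < k + A.card) : (tensorRep _ ι Xᵀ ^ k) (mixedTensor Q J S T A) = 0 := by
  induction k generalizing A with
  | zero =>
    have := A.card_le_univ
    simp at this
    omega
  | succ k ih =>
    rw [pow_succ, Module.End.mul_apply, tensorRep_mixedTensor hJ hS hT, map_sum]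
    refine Finset.sum_eq_zero fun i hi => ?_
    rw [map_smul, ih, smul_zero]
    rw [Finset.card_insert_of_notMem (by simpa using hi)]
    omega

theorem exists_lowestWeight_of_orthogonal_frame {n : ℕ} {V : Type*} [AddCommGroup V] [Module ℂ V]
    [FiniteDimensional ℂ V] {ρ : Matrix (Fin n) (Fin n) ℂ →ₗ[ℂ] End ℂ V} (hρ : IsRep ρ)
    (hirr : ∀ W : Submodule ℂ V, (∀ X, ∀ v ∈ W, ρ X v ∈ W) → W = ⊥ ∨ W = ⊤)
    {H E F : Matrix (Fin n) (Fin n) ℂ} (t : IsSl2 (ρ H) (ρ E) (ρ F))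
    {l : Fin n → ℕ} (hl : Antitone l) {v : V} (hv0 : v ≠ 0)
    (hv : IsHighest ρ (fun i => (l i : ℂ)) v) {J S T : Matrix (Fin n) (Fin n) ℂ}
    (hHJ : Hᵀ * J + J * H = 0) (hHS : Hᵀ * S + S * H = 0)
    (hEJ : Eᵀ * J + J * E = 0) (hES : Eᵀ * S + S * E = (2 : ℂ) • T) (hET : Eᵀ * T + T * E = 0)
    (hJ : ∀ i j, J i j ≠ 0 ↔ i = j) (hS : Sᵀ = -S) (r : Fin p × Fin 2 → Fin n)
    (hr : Function.Injective r) (hrl : ∀ a, Odd (l a) ↔ ∃ x, r x = a)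
    (hSr : ∀ i a, S (r (i, 0)) a ≠ 0 ↔ a = r (i, 1))
    (hSr' : ∀ i a, S (r (i, 1)) a ≠ 0 ↔ a = r (i, 0)) :
    ∃ i < p + 1, ∃ u, u ≠ 0 ∧ ρ H u = (-(0 + 2 * i : ℕ) : ℂ) • u ∧ ρ F u = 0 := by
  let B := ((Σ a, Fin (l a / 2)) ⊕ Fin p) × Fin 2 ⊕ Fin 0
  let row : B → Fin n := Sum.elim (fun x => Sum.elim (fun e => e.1) (fun i => r (i, x.2)) x.1)
    Fin.elim0
  let col : B → ℕ := Sum.elim (fun x => Sum.elim (fun e => 2 * e.2.1 + x.2)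
    (fun i => l (r (i, x.2)) - 1) x.1) Fin.elim0
  have hodd : ∀ x, l (r x) % 2 = 1 := fun x => Nat.odd_iff.1 ((hrl _).2 ⟨x, rfl⟩)
  have hfill : IsFilling row col l := by
    refine ⟨?_, ?_, ?_⟩
    · rintro (⟨⟨a, k⟩ | i, ε⟩ | x) (⟨⟨a', k'⟩ | i', ε'⟩ | x') h1 h2
      · simp only [row, col, Sum.elim_inl] at h1 h2
        subst h1
        have e1 : ε = ε' := by ext; omega
        have e2 : k = k' := by ext; omega
        rw [e1, e2]
      · simp only [row, col, Sum.elim_inl, Sum.elim_inr] at h1 h2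
        subst h1
        have := hodd (i', ε')
        have := k.2
        omega
      · exact x'.elim0
      · simp only [row, col, Sum.elim_inl, Sum.elim_inr] at h1 h2
        subst h1
        have := hodd (i, ε)
        have := k'.2
        omega
      · simp only [row, Sum.elim_inl, Sum.elim_inr] at h1
        have := hr h1
        simp only [Prod.mk.injEq] at this
        rw [this.1, this.2]
      · exact x'.elim0
      all_goals exact x.elim0
    · rintro (⟨⟨a, k⟩ | i, ε⟩ | x)
      · simp only [row, col, Sum.elim_inl]
        have := k.2
        omega
      · simp only [row, col, Sum.elim_inl, Sum.elim_inr]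
        have := hodd (i, ε)
        omega
      · exact x.elim0
    · intro a k hk
      by_cases h : k / 2 < l a / 2
      · exact ⟨.inl (.inl ⟨a, ⟨k / 2, h⟩⟩, ⟨k % 2, by omega⟩), rfl, by
          simp only [col, Sum.elim_inl]; omega⟩
      · obtain ⟨⟨i, ε⟩, hx⟩ := (hrl a).1 (Nat.odd_iff.2 (by omega))
        refine ⟨.inl (.inr i, ε), hx, ?_⟩
        simp only [col, Sum.elim_inl, Sum.elim_inr, hx]
        omega
  have hval : ∀ c : B → Fin n, mixedTensor (Σ a, Fin (l a / 2)) J S T (∅ : Finset (Fin p)) c =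
      ∏ x, Sum.elim (fun _ : Σ a, Fin (l a / 2) => J) (fun _ : Fin p => S) x
        (c (.inl (x, 0))) (c (.inl (x, 1))) := by
    intro c
    simp [mixedTensor, blockTensor, formTensor]
  refine exists_lowestWeight_of_tensor hρ hirr t hl hv0 hv hfill
    (mixedTensor (Σ a, Fin (l a / 2)) J S T (∅ : Finset (Fin p))) 0 (p + 1) ?_ ?_ ?_ ?_
  · rw [mixedTensor, tensorRep_blockTensor_of_eq_zero, ← blockTensor_smul]
    · congr 1
      simp [tensorRep]
    · rintro (x | i)
      · rw [Sum.elim_inl, tensorRep_formTensor, hHJ]; rfl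
      · rw [Sum.elim_inr, tensorRep_formTensor, if_neg (Finset.notMem_empty _), hHS]; rfl
  · exact tensorRep_pow_mixedTensor hEJ hES hET _ _ (by simp)
  · rw [hval, Finset.prod_ne_zero_iff]
    rintro (e | i) -
    · exact (hJ _ _).2 rfl
    · exact (hSr i _).2 rfl
  · intro σ hσ hne
    rw [hval, Finset.prod_ne_zero_iff] at hne
    have hE : ∀ e : Σ a, Fin (l a / 2), ∃ e' : Σ a, Fin (l a / 2),
        σ (.inl (.inl e, 0)) = .inl (.inl e', 0) ∧ σ (.inl (.inl e, 1)) = .inl (.inl e', 1) := by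
      intro e
      have h1 := (hJ _ _).1 (hne (.inl e) (Finset.mem_univ _))
      have hc0 := hσ (.inl (.inl e, 0))
      have hc1 := hσ (.inl (.inl e, 1))
      simp only [Function.comp_apply] at h1
      generalize h0' : σ (.inl (.inl e, 0)) = b0 at *
      generalize h1' : σ (.inl (.inl e, 1)) = b1 at *
      rcases b1 with ⟨⟨a', k'⟩ | i', ε'⟩ | x
      · have e1 : ε' = 1 := by
          simp only [col, Sum.elim_inl] at hc1
          ext; simp at hc1 ⊢; omega
        subst e1
        refine ⟨⟨a', k'⟩, hfill.inj _ _ h1 ?_, rfl⟩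
        rw [hc0]
        simp [col] at hc1 ⊢
        omega
      · have := hodd (i', ε')
        simp [col] at hc1
        omega
      · exact x.elim0
    choose τ hτ0 hτ1 using hE
    have hτ : Function.Surjective τ := by
      refine Finite.surjective_of_injective fun e e' h => ?_
      have : σ (.inl (.inl e, 0)) = σ (.inl (.inl e', 0)) := by rw [hτ0, hτ0, h]
      exact Sum.inl.inj (congrArg Prod.fst (Sum.inl.inj (σ.injective this)))
    have hR : ∀ i ε, ∃ x : Fin p × Fin 2, σ (.inl (.inr i, ε)) = .inl (.inr x.1, x.2) := by
      intro i ε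
      rcases hb : σ (.inl (.inr i, ε)) with ⟨⟨e⟩ | i', ε'⟩ | x
      · exfalso
        obtain ⟨e, rfl⟩ := hτ ‹_›
        have : ε' = 0 ∨ ε' = 1 := by omega
        rcases this with rfl | rfl
        · rw [← hτ0] at hb
          exact Sum.inr_ne_inl (congrArg Prod.fst (Sum.inl.inj (σ.injective hb)))
        · rw [← hτ1] at hb
          exact Sum.inr_ne_inl (congrArg Prod.fst (Sum.inl.inj (σ.injective hb)))
      · exact ⟨(i', ε'), rfl⟩
      · exact x.elim0
    have hS' : ∀ a b, S a b = - S b a := fun a b => congrFun (congrFun hS b) a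
    rw [hval, hval]
    refine sign_mul_prod_pairs σ (fun x => x.elim0)
      (fun x b b' => Sum.elim (fun _ : Σ a, Fin (l a / 2) => J) (fun _ : Fin p => S) x
        (row b) (row b')) ?_
    rintro (e | i)
    · exact ⟨.inl (τ e), .inl ⟨hτ0 e, hτ1 e, rfl⟩⟩
    · obtain ⟨⟨j, ε⟩, h0⟩ := hR i 0
      obtain ⟨⟨j', ε'⟩, h1⟩ := hR i 1
      have h2 := hne (.inr i) (Finset.mem_univ _)
      simp only [Function.comp_apply, h0, h1, Sum.elim_inr] at h2
      have : ε = 0 ∨ ε = 1 := by omega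
      rcases this with rfl | rfl
      · have := hr ((hSr j _).1 h2)
        simp only [Prod.mk.injEq] at this
        obtain ⟨rfl, rfl⟩ := this
        exact ⟨.inr j', .inl ⟨h0, h1, rfl⟩⟩
      · have := hr ((hSr' j _).1 h2)
        simp only [Prod.mk.injEq] at this
        obtain ⟨rfl, rfl⟩ := this
        exact ⟨.inr j', .inr ⟨h0, h1, hS' _ _⟩⟩

end OddCase

section EvenCase

variable {r : ℕ}

/-- The index `2 * s + ε`. -/
def pairIdx (s : Fin r) (ε : Fin 2) : Fin (2 * r) := ⟨2 * s + ε, by omega⟩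

theorem pairIdx_inj {s s' : Fin r} {ε ε' : Fin 2} (h : pairIdx s ε = pairIdx s' ε') :
    s = s' ∧ ε = ε' := by
  simp only [pairIdx, Fin.mk.injEq] at h
  constructor <;> ext <;> omega

theorem exists_pairIdx (i : Fin (2 * r)) : ∃ s ε, pairIdx s ε = i :=
  ⟨⟨i / 2, by omega⟩, ⟨i % 2, by omega⟩, by ext; simp only [pairIdx]; omega⟩

theorem exists_lowestWeight_of_symplectic_frame {L : Type*} [Fintype L] [DecidableEq L]
    {V : Type*} [AddCommGroup V] [Module ℂ V]
    [FiniteDimensional ℂ V] {ρ : Matrix (Fin (2 * r)) (Fin (2 * r)) ℂ →ₗ[ℂ] End ℂ V}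
    (hρ : IsRep ρ)
    (hirr : ∀ W : Submodule ℂ V, (∀ X, ∀ v ∈ W, ρ X v ∈ W) → W = ⊥ ∨ W = ⊤)
    {H E F : Matrix (Fin (2 * r)) (Fin (2 * r)) ℂ} (t : IsSl2 (ρ H) (ρ E) (ρ F))
    {l : Fin (2 * r) → ℕ} (hl : Antitone l) {v : V} (hv0 : v ≠ 0)
    (hv : IsHighest ρ (fun i => (l i : ℂ)) v) {J : Matrix (Fin (2 * r)) (Fin (2 * r)) ℂ}
    (hHJ : Hᵀ * J + J * H = 0) (hEJ : Eᵀ * J + J * E = 0) (hJskew : Jᵀ = -J)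
    (hJ : ∀ s ε s' ε', J (pairIdx s ε) (pairIdx s' ε') ≠ 0 ↔ s = s' ∧ ε ≠ ε')
    (g : L ≃ Σ s : Fin r, Fin (l (pairIdx s 0) - l (pairIdx s 1)))
    (τ : (L → Fin (2 * r)) → ℂ) (m q : ℕ)
    (hHτ : tensorRep L (Fin (2 * r)) Hᵀ τ = (-m : ℂ) • τ)
    (hEτ : (tensorRep L (Fin (2 * r)) Eᵀ ^ q) τ = 0)
    (hτ : τ (fun y => pairIdx (g y).1 0) ≠ 0) :
    ∃ i < q, ∃ u, u ≠ 0 ∧ ρ H u = (-(m + 2 * i : ℕ) : ℂ) • u ∧ ρ F u = 0 := by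
  let P := Σ s : Fin r, Fin (l (pairIdx s 1))
  let row : P × Fin 2 ⊕ L → Fin (2 * r) :=
    Sum.elim (fun x => pairIdx x.1.1 x.2) fun y => pairIdx (g y).1 0
  let col : P × Fin 2 ⊕ L → ℕ :=
    Sum.elim (fun x => x.1.2) fun y => l (pairIdx (g y).1 1) + (g y).2
  have hl01 : ∀ s : Fin r, l (pairIdx s 1) ≤ l (pairIdx s 0) := fun s =>
    hl (by simp [pairIdx])
  have hfill : IsFilling row col l := by
    refine ⟨?_, ?_, ?_⟩
    · rintro (⟨⟨s, k⟩, ε⟩ | y) (⟨⟨s', k'⟩, ε'⟩ | y') h1 h2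
      · simp only [row, col, Sum.elim_inl] at h1 h2
        obtain ⟨rfl, rfl⟩ := pairIdx_inj h1
        have : k = k' := Fin.ext h2
        rw [this]
      · simp only [row, col, Sum.elim_inl, Sum.elim_inr] at h1 h2
        obtain ⟨rfl, rfl⟩ := pairIdx_inj h1
        have := k.2
        omega
      · simp only [row, col, Sum.elim_inl, Sum.elim_inr] at h1 h2
        obtain ⟨rfl, rfl⟩ := pairIdx_inj h1
        have := k'.2
        omega
      · simp only [row, col, Sum.elim_inr] at h1 h2
        obtain ⟨h3, -⟩ := pairIdx_inj h1
        congr 1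
        apply g.injective
        generalize g y = a at *
        generalize g y' = a' at *
        obtain ⟨s, k⟩ := a
        obtain ⟨s', k'⟩ := a'
        dsimp only at h3 h2
        subst h3
        have : k = k' := by ext; omega
        rw [this]
    · rintro (⟨⟨s, k⟩, ε⟩ | y)
      · simp only [row, col, Sum.elim_inl]
        have := k.2
        have h0 : ε = 0 ∨ ε = 1 := by omega
        rcases h0 with rfl | rfl
        · exact this.trans_le (hl01 s)
        · exact this
      · simp only [row, col, Sum.elim_inr]
        have := (g y).2.2
        omega
    · intro i k hk
      obtain ⟨s, ε, rfl⟩ := exists_pairIdx i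
      by_cases h : k < l (pairIdx s 1)
      · exact ⟨.inl (⟨s, ⟨k, h⟩⟩, ε), rfl, rfl⟩
      · have h0 : ε = 0 ∨ ε = 1 := by omega
        rcases h0 with rfl | rfl
        · obtain ⟨y, hy⟩ := g.surjective ⟨s, ⟨k - l (pairIdx s 1), by omega⟩⟩
          refine ⟨.inr y, ?_, ?_⟩
          · simp only [row, Sum.elim_inr]
            rw [hy]
          · simp only [col, Sum.elim_inr]
            rw [hy]
            dsimp only
            omega
        · exact absurd hk h
  have hcol : ∀ y y' : L, col (.inr y) = col (.inr y') → y = y' := by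
    intro y y' h
    simp only [col, Sum.elim_inr] at h
    have hy := (g y).2.2
    have hy' := (g y').2.2
    have key : ∀ s s' : Fin r, s < s' → l (pairIdx s' 0) ≤ l (pairIdx s 1) := fun s s' hs =>
      hl (by simp [pairIdx, Fin.le_def]; omega)
    have hs : (g y).1 = (g y').1 := by
      rcases lt_trichotomy (g y).1 (g y').1 with h1 | h1 | h1
      · have := key _ _ h1; have := hl01 (g y).1; have := hl01 (g y').1; omega
      · exact h1
      · have := key _ _ h1; have := hl01 (g y).1; have := hl01 (g y').1; omega
    have := hfill.inj (.inr y) (.inr y') (by simp [row, hs]) h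
    exact Sum.inr.inj this
  have hval : ∀ c : P × Fin 2 ⊕ L → Fin (2 * r),
      blockTensor (fun _ : P => formTensor J) τ c =
        (∏ x : P, J (c (.inl (x, 0))) (c (.inl (x, 1)))) * τ fun y => c (.inr y) :=
    fun c => rfl
  have hJ0 : ∀ {X : Matrix (Fin (2 * r)) (Fin (2 * r)) ℂ}, Xᵀ * J + J * X = 0 →
      tensorRep (Fin 2) _ Xᵀ (formTensor J) = 0 := by
    intro X hX
    rw [tensorRep_formTensor, hX]; rfl
  refine exists_lowestWeight_of_tensor hρ hirr t hl hv0 hv hfill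
    (blockTensor (fun _ : P => formTensor J) τ) m q ?_ ?_ ?_ ?_
  · rw [tensorRep_blockTensor_of_eq_zero _ _ _ fun _ => hJ0 hHJ, hHτ, blockTensor_smul]
  · rw [tensorRep_pow_blockTensor_of_eq_zero _ _ _ fun _ => hJ0 hEJ, hEτ]
    ext c; simp [blockTensor]
  · rw [hval]
    refine mul_ne_zero (Finset.prod_ne_zero_iff.2 fun x _ => ?_) hτ
    exact (hJ _ _ _ _).2 ⟨rfl, zero_ne_one⟩
  · intro σ hσ hne
    rw [hval] at hne
    have hne := Finset.prod_ne_zero_iff.1 (left_ne_zero_of_mul hne)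
    have hE : ∀ e : P, ∃ e' : P, ∃ ε ε' : Fin 2, ε ≠ ε' ∧
        σ (.inl (e, 0)) = .inl (e', ε) ∧ σ (.inl (e, 1)) = .inl (e', ε') := by
      intro e
      have h1 := hne e (Finset.mem_univ _)
      have hc0 := hσ (.inl (e, 0))
      have hc1 := hσ (.inl (e, 1))
      have hc : col (.inl (e, 0)) = col (.inl (e, 1)) := rfl
      simp only [Function.comp_apply] at h1
      generalize h0' : σ (.inl (e, 0)) = b0 at *
      generalize h1' : σ (.inl (e, 1)) = b1 at *
      obtain ⟨s, ε, hs⟩ := exists_pairIdx (row b0)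
      obtain ⟨s', ε', hs'⟩ := exists_pairIdx (row b1)
      rw [← hs, ← hs', hJ] at h1
      obtain ⟨rfl, hεε⟩ := h1
      have hlt : col (.inl (e, 0)) < l (pairIdx s 1) := by
        have h2 := hfill.lt b0
        have h3 := hfill.lt b1
        rw [← hs] at h2
        rw [← hs'] at h3
        have : ε = 1 ∨ ε' = 1 := by omega
        rcases this with rfl | rfl
        · rwa [hc0] at h2
        · rwa [hc1, ← hc] at h3
      refine ⟨⟨s, ⟨_, hlt⟩⟩, ε, ε', hεε, hfill.inj _ _ hs.symm hc0, hfill.inj _ _ hs'.symm ?_⟩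
      rw [hc1]; rfl
    choose ν ε ε' hεε hν0 hν1 using hE
    have hνs : Function.Surjective ν := by
      refine Finite.surjective_of_injective fun e e' h => ?_
      by_cases h1 : ε e = ε e'
      · have : σ (.inl (e, 0)) = σ (.inl (e', 0)) := by rw [hν0, hν0, h, h1]
        exact congrArg Prod.fst (Sum.inl.inj (σ.injective this))
      · have h2 : ε e = ε' e' := by have := hεε e'; omega
        have : σ (.inl (e, 0)) = σ (.inl (e', 1)) := by rw [hν0, hν1, h, h2]
        exact congrArg Prod.fst (Sum.inl.inj (σ.injective this))
    have hL : ∀ y, σ (.inr y) = .inr y := by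
      intro y
      rcases hb : σ (.inr y) with ⟨e, δ⟩ | y'
      · exfalso
        obtain ⟨e, rfl⟩ := hνs e
        by_cases h1 : δ = ε e
        · rw [h1, ← hν0] at hb
          exact Sum.inr_ne_inl (σ.injective hb)
        · have h2 : δ = ε' e := by have := hεε e; omega
          rw [h2, ← hν1] at hb
          exact Sum.inr_ne_inl (σ.injective hb)
      · have := hσ (.inr y)
        rw [hb] at this
        rw [hcol _ _ this]
    have hJ' : ∀ a b, J a b = - J b a := fun a b => congrFun (congrFun hJskew b) a
    rw [hval, hval]
    simp only [Function.comp_apply, hL]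
    rw [← mul_assoc]
    congr 1
    refine sign_mul_prod_pairs σ hL (fun _ b b' => J (row b) (row b')) fun e => ⟨ν e, ?_⟩
    have := hεε e
    have h0 : (ε e = 0 ∧ ε' e = 1) ∨ (ε e = 1 ∧ ε' e = 0) := by omega
    rcases h0 with h0 | h0
    · exact .inl ⟨h0.1 ▸ hν0 e, h0.2 ▸ hν1 e, rfl⟩
    · exact .inr ⟨h0.1 ▸ hν0 e, h0.2 ▸ hν1 e, hJ' _ _⟩

theorem exists_lowestWeight_of_quartic {V : Type*} [AddCommGroup V] [Module ℂ V]
    [FiniteDimensional ℂ V] {ρ : Matrix (Fin (2 * r)) (Fin (2 * r)) ℂ →ₗ[ℂ] End ℂ V}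
    (hρ : IsRep ρ)
    (hirr : ∀ W : Submodule ℂ V, (∀ X, ∀ v ∈ W, ρ X v ∈ W) → W = ⊥ ∨ W = ⊤)
    {H E F : Matrix (Fin (2 * r)) (Fin (2 * r)) ℂ} (t : IsSl2 (ρ H) (ρ E) (ρ F))
    {l : Fin (2 * r) → ℕ} (hl : Antitone l) {v : V} (hv0 : v ≠ 0)
    (hv : IsHighest ρ (fun i => (l i : ℂ)) v) {J : Matrix (Fin (2 * r)) (Fin (2 * r)) ℂ}
    (hHJ : Hᵀ * J + J * H = 0) (hEJ : Eᵀ * J + J * E = 0) (hJskew : Jᵀ = -J)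
    (hJ : ∀ s ε s' ε', J (pairIdx s ε) (pairIdx s' ε') ≠ 0 ↔ s = s' ∧ ε ≠ ε')
    (Q : (Fin 4 → Fin (2 * r)) → ℂ) (hHQ : tensorRep (Fin 4) _ Hᵀ Q = 0)
    (hEQ : tensorRep (Fin 4) _ Eᵀ Q = 0) (hQ : ∀ a : Fin 4 → Fin r, Q (fun k => pairIdx (a k) 0) ≠ 0)
    (N : ℕ) (htail : ∀ s < 4, ∃ (τ : (Fin s → Fin (2 * r)) → ℂ) (m q : ℕ),
      tensorRep (Fin s) _ Hᵀ τ = (-m : ℂ) • τ ∧ (tensorRep (Fin s) _ Eᵀ ^ q) τ = 0 ∧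
      (∀ a : Fin s → Fin r, τ (fun k => pairIdx (a k) 0) ≠ 0) ∧ ∀ i < q, m + 2 * i < N) :
    ∃ d < N, ∃ u, u ≠ 0 ∧ ρ H u = (-(d : ℕ) : ℂ) • u ∧ ρ F u = 0 := by
  set A := Σ s : Fin r, Fin (l (pairIdx s 0) - l (pairIdx s 1))
  obtain ⟨τ, m, q, h1, h2, h3, h4⟩ := htail (Fintype.card A % 4) (by omega)
  let g : Fin (Fintype.card A / 4) × Fin 4 ⊕ Fin (Fintype.card A % 4) ≃ A :=
    Fintype.equivOfCardEq (by simp; omega)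
  obtain ⟨i, hi, u, hu⟩ := exists_lowestWeight_of_symplectic_frame hρ hirr t hl hv0 hv hHJ hEJ
    hJskew hJ g (blockTensor (fun _ => Q) τ) m q
    (by rw [tensorRep_blockTensor_of_eq_zero _ _ _ fun _ => hHQ, h1, blockTensor_smul])
    (by
      rw [tensorRep_pow_blockTensor_of_eq_zero _ _ _ fun _ => hEQ, h2]
      ext c; simp [blockTensor])
    (mul_ne_zero (Finset.prod_ne_zero_iff.2 fun x _ => hQ _) (h3 _))
  exact ⟨_, h4 i hi, u, hu⟩

end EvenCase

section Tails

variable {ι : Type*} [Fintype ι] [DecidableEq ι]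

theorem transpose_mul_add_mul_of_skew {J X : Matrix ι ι ℂ} (hX : Xᵀ * J + J * X = 0)
    (Y : Matrix ι ι ℂ) : Xᵀ * (J * Y) + J * Y * X = J * (Y * X - X * Y) := by
  have : Xᵀ * J = -(J * X) := eq_neg_of_add_eq_zero_left hX
  rw [← Matrix.mul_assoc, this]
  noncomm_ring

theorem tensorRep_form_mul_form (X M N : Matrix ι ι ℂ) :
    tensorRep (Fin 4) ι Xᵀ (fun c => M (c 0) (c 1) * N (c 2) (c 3)) = fun c =>
      (Xᵀ * M + M * X) (c 0) (c 1) * N (c 2) (c 3) +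
        M (c 0) (c 1) * (Xᵀ * N + N * X) (c 2) (c 3) := by
  have hN : ∀ (b : Fin 4), b ≠ 2 → b ≠ 3 → ∀ (c : Fin 4 → ι) a,
      N (Function.update c b a 2) (Function.update c b a 3) = N (c 2) (c 3) := by
    intro b h2 h3 c a
    rw [Function.update_of_ne h2.symm, Function.update_of_ne h3.symm]
  have hM : ∀ (b : Fin 4), b ≠ 0 → b ≠ 1 → ∀ (c : Fin 4 → ι) a,
      M (Function.update c b a 0) (Function.update c b a 1) = M (c 0) (c 1) := by
    intro b h2 h3 c a
    rw [Function.update_of_ne h2.symm, Function.update_of_ne h3.symm]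
  have hcomm : (fun c : Fin 4 → ι => M (c 0) (c 1) * N (c 2) (c 3)) =
      fun c => N (c 2) (c 3) * M (c 0) (c 1) := by ext; ring
  rw [tensorRep_apply, Fin.sum_univ_four,
    slotRep_mul_of_indep 0 _ (fun c => M (c 0) (c 1)) _ (hN 0 (by decide) (by decide)),
    slotRep_mul_of_indep 1 _ (fun c => M (c 0) (c 1)) _ (hN 1 (by decide) (by decide)), hcomm,
    slotRep_mul_of_indep 2 _ (fun c => N (c 2) (c 3)) _ (hM 2 (by decide) (by decide)),
    slotRep_mul_of_indep 3 _ (fun c => N (c 2) (c 3)) _ (hM 3 (by decide) (by decide)),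
    slotRep_pair_left (by decide), slotRep_pair_right (by decide),
    slotRep_pair_left (by decide), slotRep_pair_right (by decide)]
  ext c
  simp
  ring

theorem tensorRep_form_mul_covector (X M : Matrix ι ι ℂ) (w : ι → ℂ) :
    tensorRep (Fin 3) ι Xᵀ (fun c => M (c 0) (c 1) * w (c 2)) = fun c =>
      (Xᵀ * M + M * X) (c 0) (c 1) * w (c 2) + M (c 0) (c 1) * (Xᵀ *ᵥ w) (c 2) := by
  have hw : ∀ (b : Fin 3), b ≠ 2 → ∀ (c : Fin 3 → ι) a,
      w (Function.update c b a 2) = w (c 2) := by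
    intro b h2 c a
    rw [Function.update_of_ne h2.symm]
  have hM : ∀ (b : Fin 3), b ≠ 0 → b ≠ 1 → ∀ (c : Fin 3 → ι) a,
      M (Function.update c b a 0) (Function.update c b a 1) = M (c 0) (c 1) := by
    intro b h2 h3 c a
    rw [Function.update_of_ne h2.symm, Function.update_of_ne h3.symm]
  have hcomm : (fun c : Fin 3 → ι => M (c 0) (c 1) * w (c 2)) =
      fun c => w (c 2) * M (c 0) (c 1) := by ext; ring
  rw [tensorRep_apply, Fin.sum_univ_three,
    slotRep_mul_of_indep 0 _ (fun c => M (c 0) (c 1)) _ (hw 0 (by decide)),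
    slotRep_mul_of_indep 1 _ (fun c => M (c 0) (c 1)) _ (hw 1 (by decide)), hcomm,
    slotRep_mul_of_indep 2 _ (fun c => w (c 2)) _ (hM 2 (by decide) (by decide)),
    slotRep_pair_left (by decide), slotRep_pair_right (by decide), slotRep_covector]
  ext c
  simp
  ring

/-- Matrices of a copy of `𝔰𝔩₂` preserving the bilinear form `J`. -/
structure IsFormSl2 (H E F J : Matrix ι ι ℂ) : Prop where
  he : H * E - E * H = (2 : ℂ) • E
  hf : H * F - F * H = (-2 : ℂ) • F
  ef : E * F - F * E = H
  hJ : Hᵀ * J + J * H = 0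
  eJ : Eᵀ * J + J * E = 0
  fJ : Fᵀ * J + J * F = 0

namespace IsFormSl2

variable {H E F J : Matrix ι ι ℂ}

theorem h_h (s : IsFormSl2 H E F J) : Hᵀ * (J * H) + J * H * H = 0 := by
  rw [transpose_mul_add_mul_of_skew s.hJ, sub_self, Matrix.mul_zero]

theorem h_e (s : IsFormSl2 H E F J) : Hᵀ * (J * E) + J * E * H = (-2 : ℂ) • (J * E) := by
  rw [transpose_mul_add_mul_of_skew s.hJ, ← neg_sub, s.he, Matrix.mul_neg, Matrix.mul_smul, neg_smul]

theorem h_f (s : IsFormSl2 H E F J) : Hᵀ * (J * F) + J * F * H = (2 : ℂ) • (J * F) := by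
  rw [transpose_mul_add_mul_of_skew s.hJ, ← neg_sub, s.hf, Matrix.mul_neg, Matrix.mul_smul, neg_smul,
    neg_neg]

theorem e_h (s : IsFormSl2 H E F J) : Eᵀ * (J * H) + J * H * E = (2 : ℂ) • (J * E) := by
  rw [transpose_mul_add_mul_of_skew s.eJ, s.he, Matrix.mul_smul]

theorem e_e (s : IsFormSl2 H E F J) : Eᵀ * (J * E) + J * E * E = 0 := by
  rw [transpose_mul_add_mul_of_skew s.eJ, sub_self, Matrix.mul_zero]

theorem e_f (s : IsFormSl2 H E F J) : Eᵀ * (J * F) + J * F * E = -(J * H) := by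
  rw [transpose_mul_add_mul_of_skew s.eJ, ← neg_sub, s.ef, Matrix.mul_neg]

end IsFormSl2

/-- The quadratic Casimir tensor of the adjoint representation, inside the fourth tensor power. -/
def casimirTensor (H E F J : Matrix ι ι ℂ) : (Fin 4 → ι) → ℂ :=
  (fun c => (J * H) (c 0) (c 1) * (J * H) (c 2) (c 3)) +
    (2 : ℂ) • (fun c => (J * E) (c 0) (c 1) * (J * F) (c 2) (c 3)) +
    (2 : ℂ) • (fun c => (J * F) (c 0) (c 1) * (J * E) (c 2) (c 3))

theorem IsFormSl2.tensorRep_h_casimirTensor {H E F J : Matrix ι ι ℂ} (s : IsFormSl2 H E F J) :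
    tensorRep (Fin 4) ι Hᵀ (casimirTensor H E F J) = 0 := by
  simp only [casimirTensor, map_add, map_smul, tensorRep_form_mul_form, s.h_h, s.h_e, s.h_f]
  ext c
  simp
  ring

theorem IsFormSl2.tensorRep_e_casimirTensor {H E F J : Matrix ι ι ℂ} (s : IsFormSl2 H E F J) :
    tensorRep (Fin 4) ι Eᵀ (casimirTensor H E F J) = 0 := by
  simp only [casimirTensor, map_add, map_smul, tensorRep_form_mul_form, s.e_h, s.e_e, s.e_f]
  ext c
  simp
  ring

/-- A vector of lowest weight `-N` in `𝔰𝔩₂ ⊗ F_N`. -/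
def cubicTensor (H E F J : Matrix ι ι ℂ) (N : ℕ) (η : ι → ℂ) : (Fin 3 → ι) → ℂ :=
  (-N : ℂ) • (fun c => (J * H) (c 0) (c 1) * η (c 2)) +
    (2 : ℂ) • (fun c => (J * E) (c 0) (c 1) * (Fᵀ *ᵥ η) (c 2))

theorem IsFormSl2.tensorRep_h_cubicTensor {H E F J : Matrix ι ι ℂ} (s : IsFormSl2 H E F J)
    {N : ℕ} {η : ι → ℂ} (hη : Hᵀ *ᵥ η = (-N : ℂ) • η) :
    tensorRep (Fin 3) ι Hᵀ (cubicTensor H E F J N η) = (-N : ℂ) • cubicTensor H E F J N η := by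
  have h1 : Hᵀ *ᵥ (Fᵀ *ᵥ η) = (-N + 2 : ℂ) • Fᵀ *ᵥ η := by
    have h2 : Hᵀ * Fᵀ = Fᵀ * Hᵀ + (2 : ℂ) • Fᵀ := by
      have := congrArg transpose s.hf
      simp only [transpose_sub, transpose_mul, transpose_smul] at this
      rw [sub_eq_iff_eq_add] at this
      rw [this]; module
    rw [mulVec_mulVec, h2, add_mulVec, ← mulVec_mulVec, hη, mulVec_smul, smul_mulVec]
    module
  simp only [cubicTensor, map_add, map_smul, tensorRep_form_mul_covector, s.h_h, s.h_e, hη, h1]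
  ext c
  simp
  ring

theorem IsFormSl2.tensorRep_e_cubicTensor {H E F J : Matrix ι ι ℂ} (s : IsFormSl2 H E F J)
    {N : ℕ} {η : ι → ℂ} (hη : Hᵀ *ᵥ η = (-N : ℂ) • η) (hη' : Eᵀ *ᵥ η = 0) :
    tensorRep (Fin 3) ι Eᵀ (cubicTensor H E F J N η) = 0 := by
  have h1 : Eᵀ *ᵥ (Fᵀ *ᵥ η) = (N : ℂ) • η := by
    have h2 : Eᵀ * Fᵀ = Fᵀ * Eᵀ - Hᵀ := by
      have := congrArg transpose s.ef
      simp only [transpose_sub, transpose_mul] at this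
      rw [← this]; abel
    rw [mulVec_mulVec, h2, sub_mulVec, ← mulVec_mulVec, hη, hη', mulVec_zero]
    module
  simp only [cubicTensor, map_add, map_smul, tensorRep_form_mul_covector, s.e_h, s.e_e, hη', h1]
  ext c
  simp
  ring

end Tails

theorem exists_lowestWeight_of_evenFrame {r : ℕ} {V : Type*} [AddCommGroup V] [Module ℂ V]
    [FiniteDimensional ℂ V] {ρ : Matrix (Fin (2 * r)) (Fin (2 * r)) ℂ →ₗ[ℂ] End ℂ V}
    (hρ : IsRep ρ)
    (hirr : ∀ W : Submodule ℂ V, (∀ X, ∀ v ∈ W, ρ X v ∈ W) → W = ⊥ ∨ W = ⊤)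
    {H E F J : Matrix (Fin (2 * r)) (Fin (2 * r)) ℂ} (t : IsSl2 (ρ H) (ρ E) (ρ F))
    {l : Fin (2 * r) → ℕ} (hl : Antitone l) {v : V} (hv0 : v ≠ 0)
    (hv : IsHighest ρ (fun i => (l i : ℂ)) v) (s : IsFormSl2 H E F J) (hJskew : Jᵀ = -J)
    (hJ : ∀ s ε s' ε', J (pairIdx s ε) (pairIdx s' ε') ≠ 0 ↔ s = s' ∧ ε ≠ ε')
    {N : ℕ} (hN : 2 ≤ N) {η : Fin (2 * r) → ℂ} (hHη : Hᵀ *ᵥ η = (-N : ℂ) • η)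
    (hEη : Eᵀ *ᵥ η = 0) (hη : ∀ a : Fin r, η (pairIdx a 0) = 1)
    (hFη : ∀ a : Fin r, (Fᵀ *ᵥ η) (pairIdx a 0) = 0)
    (hJH : ∀ a b : Fin r, (J * H) (pairIdx a 0) (pairIdx b 0) = -2 * N)
    (hJEF : ∀ a b a' b' : Fin r, ∃ k : ℕ,
      (J * E) (pairIdx a 0) (pairIdx b 0) * (J * F) (pairIdx a' 0) (pairIdx b' 0) = k) :
    ∃ d < N + 1, ∃ u, u ≠ 0 ∧ ρ H u = (-(d : ℕ) : ℂ) • u ∧ ρ F u = 0 := by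
  have hN0 : (N : ℂ) ≠ 0 := by exact_mod_cast (by omega : N ≠ 0)
  refine exists_lowestWeight_of_quartic hρ hirr t hl hv0 hv s.hJ s.eJ hJskew hJ
    (casimirTensor H E F J) s.tensorRep_h_casimirTensor s.tensorRep_e_casimirTensor ?_ (N + 1) ?_
  · intro a
    obtain ⟨k, hk⟩ := hJEF (a 0) (a 1) (a 2) (a 3)
    obtain ⟨k', hk'⟩ := hJEF (a 2) (a 3) (a 0) (a 1)
    rw [mul_comm] at hk'
    simp only [casimirTensor, Pi.add_apply, Pi.smul_apply, hk, hk', hJH, smul_eq_mul]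
    have : 4 * N ^ 2 + 2 * k + 2 * k' ≠ 0 := by positivity
    intro h
    apply this
    have h' : ((4 * N ^ 2 + 2 * k + 2 * k' : ℕ) : ℂ) = 0 := by
      push_cast
      linear_combination h
    exact_mod_cast h'
  · intro m hm
    interval_cases m
    · exact ⟨fun _ => 1, 0, 1, by simp [tensorRep], by simp [tensorRep], by simp, by omega⟩
    · refine ⟨fun c => η (c 0), N, 1, ?_, ?_, fun a => by simp [hη], by omega⟩
      · rw [tensorRep_apply, Fin.sum_univ_one, slotRep_covector, hHη]; rfl
      · rw [pow_one, tensorRep_apply, Fin.sum_univ_one, slotRep_covector, hEη]; rfl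
    · refine ⟨formTensor (J * H), 0, 2, ?_, ?_, fun a => ?_, by omega⟩
      · rw [tensorRep_formTensor, s.h_h]; ext; simp [formTensor]
      · rw [pow_two, Module.End.mul_apply, tensorRep_formTensor, s.e_h, tensorRep_formTensor,
          Matrix.mul_smul, Matrix.smul_mul, ← smul_add, s.e_e, smul_zero]; rfl
      · simp [formTensor, hJH, hN0]
    · refine ⟨cubicTensor H E F J N η, N, 1, s.tensorRep_h_cubicTensor hHη, ?_, fun a => ?_,
        by omega⟩
      · rw [pow_one, s.tensorRep_e_cubicTensor hHη hEη]
      · simp [cubicTensor, hJH, hη, hFη, hN0]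

section Model

variable {n : ℕ}

theorem Fin.sum_ite_val_eq {M : Type*} [AddCommMonoid M] (m : ℕ) (g : Fin n → M) :
    ∑ k : Fin n, (if (k : ℕ) = m then g k else 0) = if h : m < n then g ⟨m, h⟩ else 0 := by
  split_ifs with h
  · rw [Finset.sum_eq_single ⟨m, h⟩]
    · simp
    · intro b _ hb
      rw [if_neg]
      intro hb'
      exact hb (Fin.ext hb')
    · simp
  · exact Finset.sum_eq_zero fun k _ => if_neg (by omega)

/-- The semisimple element of the principal `𝔰𝔩₂` in a basis `f ^ k v`. -/
def modelH (n : ℕ) : Matrix (Fin n) (Fin n) ℂ :=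
  Matrix.of fun i j => if (j : ℕ) = i then (n - 1 - 2 * (i : ℕ) : ℂ) else 0

/-- The raising element of the principal `𝔰𝔩₂` in a basis `f ^ k v`. -/
def modelE (n : ℕ) : Matrix (Fin n) (Fin n) ℂ :=
  Matrix.of fun i j => if (j : ℕ) = i + 1 then ((i + 1 : ℕ) * (n - 1 - (i : ℕ)) : ℂ) else 0

/-- The lowering element of the principal `𝔰𝔩₂` in a basis `f ^ k v`. -/
def modelF (n : ℕ) : Matrix (Fin n) (Fin n) ℂ :=
  Matrix.of fun i j => if (j : ℕ) + 1 = i then 1 else 0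

/-- The invariant form of the principal `𝔰𝔩₂` in a basis `f ^ k v`. -/
def modelJ (n : ℕ) : Matrix (Fin n) (Fin n) ℂ :=
  Matrix.of fun i j => if (j : ℕ) = n - 1 - i then (-1) ^ (i : ℕ) else 0

variable {P : Matrix (Fin n) (Fin n) ℂ} {U : Fin n → ℕ → ℂ}

theorem modelH_mul_apply (hP : ∀ i j, P i j = U j i) (i j : Fin n) :
    (modelH n * P) i j = (n - 1 - 2 * (i : ℕ)) * U j i := by
  simp only [Matrix.mul_apply, modelH, Matrix.of_apply, ite_mul, zero_mul, Fin.sum_ite_val_eq]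
  simp [hP]

theorem modelE_mul_apply (hP : ∀ i j, P i j = U j i) (i j : Fin n) :
    (modelE n * P) i j = ((i + 1 : ℕ) * (n - 1 - (i : ℕ)) : ℂ) * U j (i + 1) := by
  simp only [Matrix.mul_apply, modelE, Matrix.of_apply, ite_mul, zero_mul, Fin.sum_ite_val_eq]
  split_ifs with h
  · simp [hP]
  · have : (n : ℂ) = (i : ℕ) + 1 := by exact_mod_cast (by omega : n = i + 1)
    simp [this]

theorem modelF_mul_apply (hP : ∀ i j, P i j = U j i) (i j : Fin n) :
    (modelF n * P) i j = if (i : ℕ) = 0 then 0 else U j (i - 1) := by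
  have : ∀ k : Fin n, ((k : ℕ) + 1 = i) ↔ ((i : ℕ) ≠ 0 ∧ (k : ℕ) = i - 1) := by omega
  simp only [Matrix.mul_apply, modelF, Matrix.of_apply, ite_mul, zero_mul, one_mul, this, ite_and]
  by_cases h : (i : ℕ) = 0
  · simp [h]
  · simp only [ne_eq, h, not_false_eq_true, if_true, if_false]
    rw [Fin.sum_ite_val_eq, dif_pos (by omega), hP]

theorem modelJ_mul_apply (hP : ∀ i j, P i j = U j i) (i j : Fin n) :
    (modelJ n * P) i j = (-1) ^ (i : ℕ) * U j (n - 1 - i) := by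
  simp only [Matrix.mul_apply, modelJ, Matrix.of_apply, ite_mul, zero_mul, Fin.sum_ite_val_eq]
  rw [dif_pos (by omega), hP]

theorem transpose_mul_modelJ_mul_apply {M : Matrix (Fin n) (Fin n) ℂ} {Y : Fin n → ℕ → ℂ}
    (hP : ∀ i j, P i j = U j i) (hM : ∀ i j, M i j = Y j i) (i j : Fin n) :
    (Pᵀ * (modelJ n * M)) i j =
      ∑ k : Fin n, U i k * ((-1) ^ (k : ℕ) * Y j (n - 1 - k)) := by
  rw [Matrix.mul_apply]
  simp only [modelJ_mul_apply hM, Matrix.transpose_apply, hP]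

theorem transpose_mul_modelJ_apply (hP : ∀ i j, P i j = U j i) (i j : Fin n) :
    (Pᵀ * modelJ n) i j = U i (n - 1 - j) * (-1) ^ (n - 1 - j : ℕ) := by
  have : ∀ k : Fin n, ((j : ℕ) = n - 1 - k) ↔ ((k : ℕ) = n - 1 - j) := by omega
  simp only [Matrix.mul_apply, modelJ, Matrix.of_apply, mul_ite, mul_zero, this,
    Fin.sum_ite_val_eq]
  rw [dif_pos (by omega), Matrix.transpose_apply, hP]

/-- The entries of `modelH`, as functions of a natural number row index. -/
def colH (n : ℕ) (j : Fin n) (i : ℕ) : ℂ := if (j : ℕ) = i then (n - 1 - 2 * i : ℂ) else 0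

/-- The entries of `modelE`, as functions of a natural number row index. -/
def colE (n : ℕ) (j : Fin n) (i : ℕ) : ℂ :=
  if (j : ℕ) = i + 1 then ((i + 1 : ℕ) * (n - 1 - i) : ℂ) else 0

/-- The entries of `modelF`, as functions of a natural number row index. -/
def colF (n : ℕ) (j : Fin n) (i : ℕ) : ℂ := if (j : ℕ) + 1 = i then 1 else 0

theorem modelH_apply (i j : Fin n) : modelH n i j = colH n j i := rfl

theorem modelE_apply (i j : Fin n) : modelE n i j = colE n j i := rfl

theorem modelF_apply (i j : Fin n) : modelF n i j = colF n j i := rfl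

theorem isFormSl2_model : IsFormSl2 (modelH n) (modelE n) (modelF n) (modelJ n) where
  he := by
    ext i j
    rw [Matrix.sub_apply, modelH_mul_apply modelE_apply, modelE_mul_apply modelH_apply]
    simp only [colH, colE]
    simp only [modelE, Matrix.smul_apply, Matrix.of_apply]
    split_ifs
    · push_cast; simp; ring
    · simp
  hf := by
    ext i j
    rw [Matrix.sub_apply, modelH_mul_apply modelF_apply, modelF_mul_apply modelH_apply]
    simp only [colH, colF]
    simp only [modelF, Matrix.smul_apply, Matrix.of_apply]
    by_cases h : (j : ℕ) + 1 = i
    · simp [← h]; ring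
    · have h1 : ¬ ((i : ℕ) ≠ 0 ∧ (j : ℕ) = i - 1) := by omega
      simp [h]; tauto
  ef := by
    ext i j
    rw [Matrix.sub_apply, modelE_mul_apply modelF_apply, modelF_mul_apply modelE_apply]
    simp only [colE, colF]
    simp only [modelH, Matrix.of_apply]
    by_cases h : (j : ℕ) = i
    · by_cases h0 : (i : ℕ) = 0
      · simp [h, h0]
      · obtain ⟨k, hk⟩ := Nat.exists_eq_succ_of_ne_zero h0
        simp [h, hk]; ring
    · have h1 : ¬ (j : ℕ) + 1 = i + 1 := by omega
      have h2 : ¬ ((i : ℕ) ≠ 0 ∧ (j : ℕ) = i - 1 + 1) := by omega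
      simp only [if_neg h, if_neg h1]
      simp; tauto
  hJ := by
    ext i j
    rw [Matrix.add_apply, transpose_mul_modelJ_apply modelH_apply, modelJ_mul_apply modelH_apply]
    simp only [colH]
    by_cases h : (j : ℕ) = n - 1 - i
    · have h1 : (i : ℕ) = n - 1 - j := by omega
      have h2 : (n : ℂ) = i + j + 1 := by exact_mod_cast (by omega : n = i + j + 1)
      simp [← h, ← h1, h2]; ring
    · have h1 : (i : ℕ) ≠ n - 1 - j := by omega
      simp [h, h1]
  eJ := by
    ext i j
    rw [Matrix.add_apply, transpose_mul_modelJ_apply modelE_apply, modelJ_mul_apply modelE_apply]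
    simp only [colE]
    by_cases h : (j : ℕ) = n - 1 - i + 1
    · have h1 : (i : ℕ) = n - 1 - j + 1 := by omega
      have h2 : (n : ℂ) = i + j := by exact_mod_cast (by omega : n = i + j)
      have h3 : ((n - 1 - j : ℕ) : ℂ) = i - 1 := by rw [h1]; simp
      have h4 : ((n - 1 - i : ℕ) : ℂ) = j - 1 := by rw [h]; simp
      have h5 : (-1 : ℂ) ^ (i : ℕ) = - (-1) ^ (n - 1 - j : ℕ) := by
        rw [show (i : ℕ) = n - 1 - j + 1 from h1, pow_succ]; simp
      simp only [if_pos h, if_pos h1, Nat.cast_add, h3, h4, h5, h2]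
      simp; ring
    · have h1 : (i : ℕ) ≠ n - 1 - j + 1 := by omega
      simp [h, h1]
  fJ := by
    ext i j
    rw [Matrix.add_apply, transpose_mul_modelJ_apply modelF_apply, modelJ_mul_apply modelF_apply]
    simp only [colF]
    by_cases h : (j : ℕ) + 1 = n - 1 - i
    · have h1 : (i : ℕ) + 1 = n - 1 - j := by omega
      simp [← h, ← h1, pow_succ]
    · have h1 : (i : ℕ) + 1 ≠ n - 1 - j := by omega
      simp [h, h1]

theorem modelJ_transpose : (modelJ n)ᵀ = (-1 : ℂ) ^ (n - 1) • modelJ n := by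
  ext i j
  simp only [modelJ, Matrix.transpose_apply, Matrix.smul_apply, Matrix.of_apply]
  by_cases h : (j : ℕ) = n - 1 - i
  · have h1 : (i : ℕ) = n - 1 - j := by omega
    have h2 : n - 1 = i + j := by omega
    rw [if_pos h, if_pos h1, h2, pow_add, smul_eq_mul]
    linear_combination (-(-1) ^ (j : ℕ) : ℂ) * Even.neg_one_pow (α := ℂ) (Even.add_self (i : ℕ))
  · have h1 : (i : ℕ) ≠ n - 1 - j := by omega
    simp [h, h1]

end Model

section Transport

variable {V : Type*} [AddCommGroup V] [Module ℂ V] {n : ℕ}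

/-- `ρ` is an irreducible representation of the Lie algebra of all matrices. -/
structure IsIrrRep (ρ : Matrix (Fin n) (Fin n) ℂ →ₗ[ℂ] End ℂ V) : Prop where
  isRep : IsRep ρ
  irr : ∀ W : Submodule ℂ V, (∀ X, ∀ v ∈ W, ρ X v ∈ W) → W = ⊥ ∨ W = ⊤

theorem IsIrrRep.twist {ρ : Matrix (Fin n) (Fin n) ℂ →ₗ[ℂ] End ℂ V} (hρ : IsIrrRep ρ) (κ : ℂ) :
    IsIrrRep (twist ρ κ) where
  isRep := hρ.isRep.twist κ
  irr W hW := hρ.irr W fun X v hv => by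
    have h1 := hW X v hv
    rw [twist_apply] at h1
    simpa using W.sub_mem h1 (W.smul_mem (X.trace * κ) hv)

theorem IsIrrRep.permRep {ρ : Matrix (Fin n) (Fin n) ℂ →ₗ[ℂ] End ℂ V} (hρ : IsIrrRep ρ)
    (σ : Equiv.Perm (Fin n)) : IsIrrRep (permRep ρ σ) where
  isRep := hρ.isRep.permRep σ
  irr W hW := hρ.irr W fun X v hv => by
    have h1 := hW (X.submatrix σ σ) v hv
    rw [permRep_apply] at h1
    simpa using h1

/-- The representation `ρ` in the basis formed by the columns of `P`. -/
def conjRep (ρ : Matrix (Fin n) (Fin n) ℂ →ₗ[ℂ] End ℂ V) (P : Matrix (Fin n) (Fin n) ℂ) :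
    Matrix (Fin n) (Fin n) ℂ →ₗ[ℂ] End ℂ V :=
  ρ ∘ₗ LinearMap.mulRight ℂ P⁻¹ ∘ₗ LinearMap.mulLeft ℂ P

theorem conjRep_apply (ρ : Matrix (Fin n) (Fin n) ℂ →ₗ[ℂ] End ℂ V)
    (P X : Matrix (Fin n) (Fin n) ℂ) : conjRep ρ P X = ρ (P * X * P⁻¹) := rfl

theorem conjRep_conj (ρ : Matrix (Fin n) (Fin n) ℂ →ₗ[ℂ] End ℂ V)
    {P : Matrix (Fin n) (Fin n) ℂ} (hP : IsUnit P.det) (X : Matrix (Fin n) (Fin n) ℂ) :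
    conjRep ρ P (P⁻¹ * X * P) = ρ X := by
  rw [conjRep_apply, ← Matrix.mul_assoc, ← Matrix.mul_assoc, Matrix.mul_nonsing_inv _ hP,
    Matrix.one_mul, Matrix.mul_assoc, Matrix.mul_nonsing_inv _ hP, Matrix.mul_one]

theorem IsIrrRep.conjRep {ρ : Matrix (Fin n) (Fin n) ℂ →ₗ[ℂ] End ℂ V} (hρ : IsIrrRep ρ)
    {P : Matrix (Fin n) (Fin n) ℂ} (hP : IsUnit P.det) : IsIrrRep (conjRep ρ P) where
  isRep X Y v := by
    simp only [conjRep_apply]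
    rw [hρ.isRep]
    congr 3
    have h : ∀ A B : Matrix (Fin n) (Fin n) ℂ, P * A * P⁻¹ * (P * B * P⁻¹) = P * (A * B) * P⁻¹ := by
      intro A B
      calc P * A * P⁻¹ * (P * B * P⁻¹) = P * A * (P⁻¹ * P) * B * P⁻¹ := by noncomm_ring
        _ = _ := by rw [Matrix.nonsing_inv_mul _ hP]; noncomm_ring
    rw [h, h]
    noncomm_ring
  irr W hW := hρ.irr W fun X v hv => by
    have := hW (P⁻¹ * X * P) v hv
    rwa [conjRep_conj ρ hP] at this

theorem IsIrrRep.exists_twist_isHighest [FiniteDimensional ℂ V] [Nontrivial V] (hn : n ≠ 0)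
    {ρ : Matrix (Fin n) (Fin n) ℂ →ₗ[ℂ] End ℂ V} (hρ : IsIrrRep ρ) :
    ∃ (κ : ℂ) (l : Fin n → ℕ) (v : V), v ≠ 0 ∧ Antitone l ∧
      IsHighest (_root_.twist ρ κ) (fun i => (l i : ℂ)) v := by
  obtain ⟨n, rfl⟩ := Nat.exists_eq_succ_of_ne_zero hn
  obtain ⟨χ, v, hv0, hv⟩ := hρ.isRep.exists_isHighest
  obtain ⟨l, κ, hl, hχ⟩ := hv.exists_nat_weight hρ.isRep hv0
  refine ⟨-κ, l, v, hv0, hl, ?_⟩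
  convert hv.twist (-κ) using 2
  rw [hχ]; ring

theorem IsIrrRep.isHighest_perm [FiniteDimensional ℂ V]
    {ρ : Matrix (Fin n) (Fin n) ℂ →ₗ[ℂ] End ℂ V} (hρ : IsIrrRep ρ)
    {l : Fin n → ℕ} {v : V} (hv0 : v ≠ 0) (hv : IsHighest ρ (fun i => (l i : ℂ)) v)
    (σ : Equiv.Perm (Fin n)) : ∃ w, w ≠ 0 ∧
      IsHighest (_root_.permRep ρ σ) (fun i => (l i : ℂ)) w := by
  rcases n with _ | n
  · exact ⟨v, hv0, ⟨fun i => i.elim0, fun i => i.elim0⟩⟩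
  · exact hv.perm hρ.isRep hv0 σ

variable {H E F J : Matrix (Fin n) (Fin n) ℂ}

theorem IsFormSl2.isSl2 (s : IsFormSl2 H E F J)
    {ρ : Matrix (Fin n) (Fin n) ℂ →ₗ[ℂ] End ℂ V} (hρ : IsRep ρ) :
    IsSl2 (ρ H) (ρ E) (ρ F) where
  he v := by rw [hρ, s.he, map_smul, LinearMap.smul_apply]
  hf v := by rw [hρ, s.hf, map_smul, LinearMap.smul_apply]
  ef v := by rw [hρ, s.ef]

theorem IsFormSl2.trace_h (s : IsFormSl2 H E F J) : H.trace = 0 := by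
  rw [← s.ef, Matrix.trace_sub, Matrix.trace_mul_comm, sub_self]

theorem IsFormSl2.trace_f (s : IsFormSl2 H E F J) : F.trace = 0 := by
  have := congrArg trace s.hf
  rw [Matrix.trace_sub, Matrix.trace_mul_comm, sub_self, Matrix.trace_smul] at this
  simpa using this

theorem IsFormSl2.conj (s : IsFormSl2 H E F J) {P : Matrix (Fin n) (Fin n) ℂ}
    (hP : IsUnit P.det) :
    IsFormSl2 (P⁻¹ * H * P) (P⁻¹ * E * P) (P⁻¹ * F * P) (Pᵀ * (J * P)) := by
  have h : ∀ A B : Matrix (Fin n) (Fin n) ℂ, P⁻¹ * A * P * (P⁻¹ * B * P) = P⁻¹ * (A * B) * P := by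
    intro A B
    calc P⁻¹ * A * P * (P⁻¹ * B * P) = P⁻¹ * A * (P * P⁻¹) * B * P := by noncomm_ring
      _ = _ := by rw [Matrix.mul_nonsing_inv _ hP]; noncomm_ring
  have h' : ∀ A B C : Matrix (Fin n) (Fin n) ℂ, A * B - B * A = C →
      P⁻¹ * A * P * (P⁻¹ * B * P) - P⁻¹ * B * P * (P⁻¹ * A * P) = P⁻¹ * C * P := by
    intro A B C hC
    rw [h, h, ← hC]; noncomm_ring
  have hJ : ∀ A : Matrix (Fin n) (Fin n) ℂ, Aᵀ * J + J * A = 0 →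
      (P⁻¹ * A * P)ᵀ * (Pᵀ * (J * P)) + Pᵀ * (J * P) * (P⁻¹ * A * P) = 0 := by
    intro A hA
    have h1 : (P⁻¹ * A * P)ᵀ * Pᵀ = Pᵀ * Aᵀ := by
      rw [← transpose_mul, Matrix.mul_assoc, ← Matrix.mul_assoc, Matrix.mul_nonsing_inv _ hP,
        Matrix.one_mul, transpose_mul]
    have h2 : P * (P⁻¹ * A * P) = A * P := by
      rw [Matrix.mul_assoc, ← Matrix.mul_assoc, Matrix.mul_nonsing_inv _ hP, Matrix.one_mul]
    calc _ = (P⁻¹ * A * P)ᵀ * Pᵀ * (J * P) + Pᵀ * J * (P * (P⁻¹ * A * P)) := by noncomm_ring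
      _ = Pᵀ * (Aᵀ * J + J * A) * P := by rw [h1, h2]; noncomm_ring
      _ = 0 := by rw [hA]; simp
  refine ⟨?_, ?_, h' _ _ _ s.ef, hJ _ s.hJ, hJ _ s.eJ, hJ _ s.fJ⟩
  · rw [h' _ _ _ s.he]; simp
  · rw [h' _ _ _ s.hf]; simp

theorem IsFormSl2.submatrix (s : IsFormSl2 H E F J) (σ : Equiv.Perm (Fin n)) :
    IsFormSl2 (H.submatrix σ σ) (E.submatrix σ σ) (F.submatrix σ σ) (J.submatrix σ σ) where
  he := by
    rw [submatrix_mul_equiv, submatrix_mul_equiv]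
    exact congrArg (Matrix.submatrix · σ σ) s.he
  hf := by
    rw [submatrix_mul_equiv, submatrix_mul_equiv]
    exact congrArg (Matrix.submatrix · σ σ) s.hf
  ef := by
    rw [submatrix_mul_equiv, submatrix_mul_equiv]
    exact congrArg (Matrix.submatrix · σ σ) s.ef
  hJ := by
    rw [transpose_submatrix, submatrix_mul_equiv, submatrix_mul_equiv]
    exact congrArg (Matrix.submatrix · σ σ) s.hJ
  eJ := by
    rw [transpose_submatrix, submatrix_mul_equiv, submatrix_mul_equiv]
    exact congrArg (Matrix.submatrix · σ σ) s.eJ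
  fJ := by
    rw [transpose_submatrix, submatrix_mul_equiv, submatrix_mul_equiv]
    exact congrArg (Matrix.submatrix · σ σ) s.fJ

end Transport

theorem Matrix.isUnit_det_of_monomial {n : ℕ} {J P K : Matrix (Fin n) (Fin n) ℂ}
    (f : Fin n → Fin n) (hf : Function.Involutive f) (hJ : ∀ i j, J i j ≠ 0 ↔ j = f i)
    (hJP : J = K * P) : IsUnit P.det := by
  have h1 : J * J = diagonal fun i => J i (f i) * J (f i) i := by
    ext i j
    rw [Matrix.mul_apply, Finset.sum_eq_single (f i)]
    · rw [diagonal_apply]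
      split_ifs with h
      · rw [h]
      · have : J (f i) j = 0 := by
          by_contra h2
          rw [← ne_eq, hJ, hf i] at h2
          exact h h2.symm
        rw [this, mul_zero]
    · intro k _ hk
      have : J i k = 0 := by
        by_contra h2
        exact hk ((hJ _ _).1 h2)
      rw [this, zero_mul]
    · simp
  have h2 : (J * J).det ≠ 0 := by
    rw [h1, det_diagonal]
    refine Finset.prod_ne_zero_iff.2 fun i _ => mul_ne_zero ((hJ _ _).2 rfl) ((hJ _ _).2 (hf i).symm)
  rw [isUnit_iff_ne_zero]
  intro h3
  apply h2
  rw [det_mul, hJP, det_mul, h3]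
  simp

theorem conj_form_mul {n : ℕ} {J P : Matrix (Fin n) (Fin n) ℂ} (hP : IsUnit P.det)
    (X : Matrix (Fin n) (Fin n) ℂ) : Pᵀ * (J * P) * (P⁻¹ * X * P) = Pᵀ * (J * (X * P)) := by
  calc Pᵀ * (J * P) * (P⁻¹ * X * P) = Pᵀ * (J * (P * P⁻¹ * X * P)) := by noncomm_ring
    _ = _ := by rw [Matrix.mul_nonsing_inv _ hP, Matrix.one_mul]

section OddFrame

variable {V : Type*} [AddCommGroup V] [Module ℂ V] [FiniteDimensional ℂ V] {n : ℕ}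

/-- In a frame which is orthogonal for `J` and monomial for `J * H`, a lowest weight vector of
small weight exists in every irreducible representation. -/
theorem IsIrrRep.exists_lowestWeight_of_orthogonal [Nontrivial V] {r : ℕ}
    {ρ : Matrix (Fin (2 * r + 1)) (Fin (2 * r + 1)) ℂ →ₗ[ℂ] End ℂ V} (hρ : IsIrrRep ρ)
    {H E F J : Matrix (Fin (2 * r + 1)) (Fin (2 * r + 1)) ℂ} (s : IsFormSl2 H E F J)
    (hJt : Jᵀ = J) (hJ : ∀ i j, J i j ≠ 0 ↔ i = j)
    (hJH : ∀ i j, (J * H) i j ≠ 0 ↔ ((j : ℕ) + i = 2 * r ∧ (i : ℕ) ≠ r)) :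
    ∃ d < 2 * r + 1, ∃ u, u ≠ 0 ∧ ρ H u = (-(d : ℕ) : ℂ) • u ∧ ρ F u = 0 := by
  obtain ⟨κ, l, v, hv0, hl, hv, p, hp⟩ : ∃ (κ : ℂ) (l : Fin (2 * r + 1) → ℕ) (v : V), v ≠ 0 ∧
      Antitone l ∧ IsHighest (_root_.twist ρ κ) (fun i => (l i : ℂ)) v ∧
      ∃ p, Fintype.card {a // Odd (l a)} = p * 2 := by
    obtain ⟨κ, l, v, hv0, hl, hv⟩ := hρ.exists_twist_isHighest (Nat.succ_ne_zero _)
    rcases Nat.even_or_odd (Fintype.card {a // Odd (l a)}) with ⟨p, hp⟩ | ⟨p, hp⟩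
    · exact ⟨κ, l, v, hv0, hl, hv, p, by rw [mul_two, ← hp]⟩
    · have hc := Fintype.card_subtype_compl fun a => Odd (l a)
      rw [Fintype.card_fin, hp] at hc
      have hle := Fintype.card_subtype_le fun a => Odd (l a)
      rw [Fintype.card_fin, hp] at hle
      refine ⟨κ + 1, fun a => l a + 1, v, hv0, fun a b hab => Nat.succ_le_succ (hl hab), ?_,
        r - p, ?_⟩
      · have h1 := hv.twist 1
        have h2 : _root_.twist (_root_.twist ρ κ) 1 = _root_.twist ρ (κ + 1) := by
          ext X w
          simp only [twist_apply]
          module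
        rw [h2] at h1
        simpa using h1
      · rw [Fintype.card_congr (Equiv.subtypeEquivRight fun a => Nat.odd_add_one), hc]
        omega
  have hpr : p ≤ r := by
    have hle := Fintype.card_subtype_le fun a => Odd (l a)
    rw [Fintype.card_fin, hp] at hle
    omega
  have e : Fin p × Fin 2 ≃ {a // Odd (l a)} := Fintype.equivOfCardEq (by simp [hp])
  let g : Fin p × Fin 2 → Fin (2 * r + 1) := fun x =>
    ⟨if x.2 = 0 then x.1 else 2 * r - x.1, by split_ifs <;> omega⟩
  have hg : Function.Injective g := by
    rintro ⟨i, ε⟩ ⟨i', ε'⟩ h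
    simp only [g, Fin.mk.injEq] at h
    ext <;> simp only <;> split_ifs at h <;> omega
  let σ : Equiv.Perm (Fin (2 * r + 1)) :=
    Equiv.extendSubtype (p := fun a => Odd (l a)) (q := fun a => a ∈ Set.range g)
      (e.symm.trans (Equiv.ofInjective g hg))
  have hσ : ∀ x, σ (e x) = g x := by
    intro x
    refine (Equiv.extendSubtype_apply_of_mem (p := fun a => Odd (l a))
      (q := fun a => a ∈ Set.range g) _ _ (e x).2).trans ?_
    simp
  let ρ' := _root_.permRep (_root_.twist ρ κ) σ
  have hρ' : IsIrrRep ρ' := (hρ.twist κ).permRep σ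
  obtain ⟨w, hw0, hw⟩ := (hρ.twist κ).isHighest_perm hv0 hv σ
  have s' := s.submatrix σ
  have hact : ∀ X, X.trace = 0 → ρ' (X.submatrix σ σ) = ρ X := by
    intro X hX
    ext u
    simp [ρ', permRep_apply, twist_apply, hX]
  have hSJ : J.submatrix σ σ * H.submatrix σ σ = (J * H).submatrix σ σ := submatrix_mul_equiv ..
  have hSr : ∀ i ε a, (J.submatrix σ σ * H.submatrix σ σ) (e (i, ε)) a ≠ 0 ↔
      a = e (i, 1 - ε) := by
    intro i ε a
    rw [hSJ, submatrix_apply, hJH, hσ, ← σ.injective.eq_iff (b := (e (i, 1 - ε) : Fin _)), hσ,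
      Fin.ext_iff]
    fin_cases ε <;> simp [g] <;> omega
  obtain ⟨i, hi, u, hu0, hu, hFu⟩ := exists_lowestWeight_of_orthogonal_frame hρ'.isRep hρ'.irr
    (s'.isSl2 hρ'.isRep) hl hw0 hw s'.hJ s'.h_h s'.eJ s'.e_h s'.e_e
    (fun i j => by rw [submatrix_apply, hJ, σ.injective.eq_iff])
    (by
      rw [hSJ, transpose_submatrix, transpose_mul, hJt, eq_neg_of_add_eq_zero_left s.hJ]
      rfl)
    (fun x => (e x : Fin (2 * r + 1))) (Subtype.val_injective.comp e.injective)
    (fun a => ⟨fun ha => ⟨e.symm ⟨a, ha⟩, by simp⟩, by rintro ⟨x, rfl⟩; exact (e x).2⟩)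
    (fun i a => hSr i 0 a) (fun i a => hSr i 1 a)
  rw [hact _ s.trace_h] at hu
  rw [hact _ s.trace_f] at hFu
  exact ⟨2 * i, by omega, u, hu0, by simpa using hu, hFu⟩

/-- The symmetric or antisymmetric combinations `e_j ± e_{2r-j}`, as functions of the row. -/
def oddCol (r : ℕ) (j : Fin (2 * r + 1)) (i : ℕ) : ℂ :=
  (if i = j then 1 else 0) +
    if i + j = 2 * r then (if (j : ℕ) < r then 1 else if (j : ℕ) = r then 0 else -1) else 0

/-- The frame of symmetric and antisymmetric combinations `e_j ± e_{2r-j}`. -/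
def oddFrame (r : ℕ) : Matrix (Fin (2 * r + 1)) (Fin (2 * r + 1)) ℂ :=
  Matrix.of fun i j => oddCol r j i

theorem oddFrame_apply {r : ℕ} (i j : Fin (2 * r + 1)) : oddFrame r i j = oddCol r j i := rfl

theorem sum_oddCol_mul {r : ℕ} (j : Fin (2 * r + 1)) (G : ℕ → ℂ) :
    ∑ k : Fin (2 * r + 1), oddCol r j k * G k = G j +
      (if (j : ℕ) < r then 1 else if (j : ℕ) = r then 0 else -1) * G (2 * r - j) := by
  have h : ∀ k : Fin (2 * r + 1), (k : ℕ) + j = 2 * r ↔ (k : ℕ) = 2 * r - j := by omega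
  simp only [oddCol, add_mul, ite_zero_mul, one_mul, h, Finset.sum_add_distrib,
    Fin.sum_ite_val_eq]
  rw [dif_pos (by omega), dif_pos (by omega)]

theorem oddFrame_form {r : ℕ} (i j : Fin (2 * r + 1)) :
    ((oddFrame r)ᵀ * (modelJ (2 * r + 1) * oddFrame r)) i j ≠ 0 ↔ i = j := by
  rw [transpose_mul_modelJ_mul_apply oddFrame_apply oddFrame_apply,
    sum_oddCol_mul i fun k => (-1) ^ k * oddCol r j (2 * r + 1 - 1 - k)]
  have h1 : (-1 : ℂ) ^ (2 * r - i) = (-1) ^ (i : ℕ) := by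
    rw [neg_one_pow_eq_pow_mod_two, neg_one_pow_eq_pow_mod_two (n := (i : ℕ))]
    congr 1; omega
  have h2 : 2 * r + 1 - 1 - (2 * r - i) = (i : ℕ) := by omega
  have h3 : (-1 : ℂ) ^ (i : ℕ) ≠ 0 := pow_ne_zero _ (by norm_num)
  rw [h1, h2, ← mul_assoc, mul_comm _ ((-1 : ℂ) ^ (i : ℕ)), mul_assoc, ← mul_add, mul_ne_zero_iff,
    and_iff_right h3, Fin.ext_iff]
  simp only [oddCol]
  split_ifs <;> first | omega | (norm_num <;> omega)

/-- The images under `modelH` of the columns of the odd frame. -/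
def oddColH (r : ℕ) (j : Fin (2 * r + 1)) (i : ℕ) : ℂ :=
  ((2 * r + 1 : ℕ) - 1 - 2 * i) * oddCol r j i

theorem oddFrame_form_h {r : ℕ} (i j : Fin (2 * r + 1)) :
    ((oddFrame r)ᵀ * (modelJ (2 * r + 1) * (modelH (2 * r + 1) * oddFrame r))) i j ≠ 0 ↔
      ((j : ℕ) + i = 2 * r ∧ (i : ℕ) ≠ r) := by
  rw [transpose_mul_modelJ_mul_apply (Y := oddColH r) oddFrame_apply
    (modelH_mul_apply oddFrame_apply),
    sum_oddCol_mul i fun k => (-1) ^ k * oddColH r j (2 * r + 1 - 1 - k)]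
  have h1 : (-1 : ℂ) ^ (2 * r - i) = (-1) ^ (i : ℕ) := by
    rw [neg_one_pow_eq_pow_mod_two, neg_one_pow_eq_pow_mod_two (n := (i : ℕ))]
    congr 1; omega
  have h2 : 2 * r + 1 - 1 - (2 * r - i) = (i : ℕ) := by omega
  have h3 : (-1 : ℂ) ^ (i : ℕ) ≠ 0 := pow_ne_zero _ (by norm_num)
  have h4 : ((2 * r + 1 - 1 - i : ℕ) : ℂ) = 2 * r - (i : ℕ) := by
    rw [show 2 * r + 1 - 1 - (i : ℕ) = 2 * r - i from rfl, Nat.cast_sub (by omega)]; simp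
  have h5 : (r : ℂ) - (i : ℕ) = 0 ↔ (i : ℕ) = r := by
    rw [sub_eq_zero, Nat.cast_inj, eq_comm]
  rw [h1, h2, ← mul_assoc, mul_comm _ ((-1 : ℂ) ^ (i : ℕ)), mul_assoc, ← mul_add, mul_ne_zero_iff,
    and_iff_right h3]
  have h6 : oddColH r j (2 * r + 1 - 1 - i) =
      -2 * (r - (i : ℕ)) * oddCol r j (2 * r + 1 - 1 - i) := by
    rw [oddColH, h4]; push_cast; ring
  have h7 : oddColH r j i = 2 * (r - (i : ℕ)) * oddCol r j i := by
    rw [oddColH]; push_cast; ring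
  have h8 : ∀ q a b : ℂ, -2 * (r - (i : ℕ)) * a + q * (2 * (r - (i : ℕ)) * b) =
      (2 * (r - (i : ℕ))) * (q * b - a) := by intros; ring
  rw [h6, h7, h8, mul_ne_zero_iff, ne_eq, mul_eq_zero, h5]
  simp only [oddCol]
  split_ifs <;> first | omega | (norm_num <;> omega)

theorem exists_lowestWeight_model_odd [Nontrivial V] {r : ℕ}
    {ρ : Matrix (Fin (2 * r + 1)) (Fin (2 * r + 1)) ℂ →ₗ[ℂ] End ℂ V} (hρ : IsIrrRep ρ) :
    ∃ d < 2 * r + 1, ∃ u, u ≠ 0 ∧ ρ (modelH _) u = (-(d : ℕ) : ℂ) • u ∧ ρ (modelF _) u = 0 := by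
  have hP : IsUnit (oddFrame r).det :=
    Matrix.isUnit_det_of_monomial id (fun _ => rfl)
      (fun i j => (oddFrame_form i j).trans eq_comm) (Matrix.mul_assoc _ _ _).symm
  have := (hρ.conjRep hP).exists_lowestWeight_of_orthogonal (isFormSl2_model.conj hP)
    (by rw [transpose_mul, transpose_mul, modelJ_transpose, transpose_transpose]
        simp [Matrix.mul_assoc])
    oddFrame_form (by rw [conj_form_mul hP]; exact oddFrame_form_h)
  simpa only [conjRep_conj ρ hP] using this

end OddFrame

section EvenFrame

/-- The columns `e_0 + e_{2r-1} ± e_s` of the even frame, as functions of the row. -/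
def evenA (r s i : ℕ) : ℂ :=
  (if i = 0 then 1 else 0) + (if i = 2 * r - 1 then 1 else 0) +
    if s = 0 then 0 else if i = s then (-1) ^ r else 0

/-- The columns dual to `evenA` in the even frame, as functions of the row. -/
def evenY (r s i : ℕ) : ℂ :=
  if s = 0 then
    if i = 2 * r - 1 then 1 else if r ≤ i then -(-1) ^ r * (-1) ^ (2 * r - 1 - i) else 0
  else if i = 2 * r - 1 - s then 1 else 0

/-- The columns of the even frame, as functions of the row. -/
def evenCol (r : ℕ) (j : Fin (2 * r)) (i : ℕ) : ℂ :=
  if (j : ℕ) % 2 = 0 then evenA r (j / 2) i else evenY r (j / 2) i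

/-- A frame of isotropic pairs adapted to the principal `𝔰𝔩₂` in even dimension. -/
def evenFrame (r : ℕ) : Matrix (Fin (2 * r)) (Fin (2 * r)) ℂ :=
  Matrix.of fun i j => evenCol r j i

variable {r : ℕ}

theorem evenFrame_apply (i j : Fin (2 * r)) : evenFrame r i j = evenCol r j i := rfl

theorem evenCol_pairIdx_zero (s : Fin r) (i : ℕ) : evenCol r (pairIdx s 0) i = evenA r s i := by
  simp [evenCol, pairIdx]

theorem evenCol_pairIdx_one (s : Fin r) (i : ℕ) : evenCol r (pairIdx s 1) i = evenY r s i := by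
  have h : (2 * (s : ℕ) + 1) / 2 = s := by omega
  simp [evenCol, pairIdx, h]

theorem evenY_eq_zero {s i : ℕ} (hs : s < r) (hi : i < r) : evenY r s i = 0 := by
  simp only [evenY]
  split_ifs <;> first | omega | rfl

theorem sum_evenA_mul {s : ℕ} (hs : s < r) (G : ℕ → ℂ) :
    ∑ k : Fin (2 * r), evenA r s k * G k =
      G 0 + G (2 * r - 1) + if s = 0 then 0 else (-1) ^ r * G s := by
  have h : ∀ k, (if s = 0 then (0 : ℂ) else if k = s then (-1) ^ r else 0) =
      if k = s then (if s = 0 then 0 else (-1) ^ r) else 0 := by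
    intro k; split_ifs <;> rfl
  simp only [evenA, h, add_mul, ite_zero_mul, one_mul, Finset.sum_add_distrib, Fin.sum_ite_val_eq]
  rw [dif_pos (by omega), dif_pos (by omega), dif_pos (by omega)]
  split_ifs <;> simp

theorem evenFrame_form_apply (hr : 2 ≤ r) {M : Matrix (Fin (2 * r)) (Fin (2 * r)) ℂ}
    {Y : Fin (2 * r) → ℕ → ℂ} (hM : ∀ i j, M i j = Y j i) (s : Fin r) (j : Fin (2 * r)) :
    ((evenFrame r)ᵀ * (modelJ (2 * r) * M)) (pairIdx s 0) j =
      Y j (2 * r - 1) - Y j 0 +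
        if (s : ℕ) = 0 then 0 else (-1) ^ r * ((-1) ^ (s : ℕ) * Y j (2 * r - 1 - s)) := by
  rw [transpose_mul_modelJ_mul_apply evenFrame_apply hM]
  simp only [evenCol_pairIdx_zero]
  rw [sum_evenA_mul s.2 fun k => (-1) ^ k * Y j (2 * r - 1 - k)]
  have : Odd (2 * r - 1) := ⟨r - 1, by omega⟩
  simp [this.neg_one_pow]
  ring

theorem evenFrame_form_transpose (hr : 2 ≤ r) :
    ((evenFrame r)ᵀ * (modelJ (2 * r) * evenFrame r))ᵀ =
      -((evenFrame r)ᵀ * (modelJ (2 * r) * evenFrame r)) := by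
  have : Odd (2 * r - 1) := ⟨r - 1, by omega⟩
  rw [transpose_mul, transpose_mul, modelJ_transpose, transpose_transpose, this.neg_one_pow]
  simp [Matrix.mul_assoc]

theorem neg_one_pow_mul_self (m : ℕ) : (-1 : ℂ) ^ m * (-1) ^ m = 1 := by
  rw [← mul_pow]; simp

theorem evenFrame_form_zero_one (hr : 2 ≤ r) (s t : Fin r) :
    ((evenFrame r)ᵀ * (modelJ (2 * r) * evenFrame r)) (pairIdx s 0) (pairIdx t 1) ≠ 0 ↔
      s = t := by
  have h1 : (-1 : ℂ) ^ r ≠ 0 := pow_ne_zero _ (by norm_num)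
  have h2 : (-1 : ℂ) ^ (s : ℕ) ≠ 0 := pow_ne_zero _ (by norm_num)
  have h3 : 2 * r - 1 - (2 * r - 1 - s) = (s : ℕ) := by omega
  have h4 : (1 : ℂ) + (-1) ^ r * ((-1) ^ (s : ℕ) * (-(-1) ^ r * (-1) ^ (s : ℕ))) = 0 := by
    linear_combination (-(-1) ^ (s : ℕ) * (-1) ^ (s : ℕ)) * neg_one_pow_mul_self r -
      neg_one_pow_mul_self (s : ℕ)
  rw [evenFrame_form_apply hr evenFrame_apply, Fin.ext_iff]
  simp only [evenCol_pairIdx_one]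
  rw [evenY_eq_zero (i := 0) t.2 (by omega), sub_zero]
  simp only [evenY, h3]
  have hs := s.2
  have ht := t.2
  split_ifs <;> first
    | omega
    | exact iff_of_false (not_not.2 h4) (by omega)
    | exact iff_of_false (by simp) (by omega)
    | exact iff_of_true (by simp) (by omega)

theorem evenFrame_form (hr : 2 ≤ r) (s : Fin r) (ε : Fin 2) (t : Fin r) (δ : Fin 2) :
    ((evenFrame r)ᵀ * (modelJ (2 * r) * evenFrame r)) (pairIdx s ε) (pairIdx t δ) ≠ 0 ↔
      s = t ∧ ε ≠ δ := by
  have hs := s.2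
  have ht := t.2
  have h00 : ((evenFrame r)ᵀ * (modelJ (2 * r) * evenFrame r)) (pairIdx s 0) (pairIdx t 0) = 0 := by
    rw [evenFrame_form_apply hr evenFrame_apply]
    simp only [evenCol_pairIdx_zero, evenA]
    split_ifs <;> first | omega | contradiction | simp
  have h11 : ((evenFrame r)ᵀ * (modelJ (2 * r) * evenFrame r)) (pairIdx s 1) (pairIdx t 1) = 0 := by
    rw [transpose_mul_modelJ_mul_apply evenFrame_apply evenFrame_apply]
    refine Finset.sum_eq_zero fun k _ => ?_
    rw [evenCol_pairIdx_one, evenCol_pairIdx_one]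
    rcases lt_or_ge (k : ℕ) r with hk | hk
    · rw [evenY_eq_zero hs hk, zero_mul]
    · rw [evenY_eq_zero (i := 2 * r - 1 - k) ht (by omega), mul_zero, mul_zero]
  fin_cases ε <;> fin_cases δ
  · simpa using h00
  · simpa using evenFrame_form_zero_one hr s t
  · have h := congrFun (congrFun (evenFrame_form_transpose hr) (pairIdx s 1)) (pairIdx t 0)
    rw [transpose_apply, Matrix.neg_apply] at h
    have h' := evenFrame_form_zero_one hr t s
    rw [h, neg_ne_zero] at h'
    simpa [eq_comm] using h'
  · simpa using h11

/-- The images under `modelH` of the columns of the even frame. -/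
def evenColH (r : ℕ) (j : Fin (2 * r)) (i : ℕ) : ℂ :=
  ((2 * r : ℕ) - 1 - 2 * i) * evenCol r j i

/-- The images under `modelE` of the columns of the even frame. -/
def evenColE (r : ℕ) (j : Fin (2 * r)) (i : ℕ) : ℂ :=
  ((i + 1 : ℕ) * ((2 * r : ℕ) - 1 - i) : ℂ) * evenCol r j (i + 1)

/-- The images under `modelF` of the columns of the even frame. -/
def evenColF (r : ℕ) (j : Fin (2 * r)) (i : ℕ) : ℂ :=
  if i = 0 then 0 else evenCol r j (i - 1)

theorem evenFrame_form_h (hr : 2 ≤ r) (s t : Fin r) :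
    ((evenFrame r)ᵀ * (modelJ (2 * r) * (modelH (2 * r) * evenFrame r)))
      (pairIdx s 0) (pairIdx t 0) = -2 * (2 * r - 1 : ℕ) := by
  have hs := s.2
  have ht := t.2
  rw [evenFrame_form_apply (Y := evenColH r) hr (modelH_mul_apply evenFrame_apply)]
  have h1 : ((2 * r - 1 : ℕ) : ℂ) = 2 * r - 1 := by rw [Nat.cast_sub (by omega)]; simp
  simp only [evenColH, evenCol_pairIdx_zero, evenA, h1]
  push_cast
  split_ifs <;> first | omega | (simp; try ring)

theorem evenFrame_form_e (hr : 2 ≤ r) (s t : Fin r) :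
    ((evenFrame r)ᵀ * (modelJ (2 * r) * (modelE (2 * r) * evenFrame r)))
      (pairIdx s 0) (pairIdx t 0) = -(2 * r - 1 : ℕ) * (-1) ^ r *
        ((if (s : ℕ) = 1 then 1 else 0) + if (t : ℕ) = 1 then 1 else 0) := by
  have hs := s.2
  have ht := t.2
  rw [evenFrame_form_apply (Y := evenColE r) hr (modelE_mul_apply evenFrame_apply)]
  have h1 : ((2 * r - 1 : ℕ) : ℂ) = 2 * r - 1 := by rw [Nat.cast_sub (by omega)]; simp
  have h2 : ((2 * r - 1 - s : ℕ) : ℂ) = 2 * r - 1 - (s : ℕ) := by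
    rw [Nat.cast_sub (by omega), h1]
  have h3 : evenA r t 1 = if (t : ℕ) = 1 then (-1) ^ r else 0 := by
    simp only [evenA]
    split_ifs <;> first | omega | contradiction | simp
  have h4 : (s : ℕ) ≠ 0 → evenA r t (2 * r - 1 - s + 1) = if (s : ℕ) = 1 then 1 else 0 := by
    intro h
    simp only [evenA]
    split_ifs <;> first | omega | contradiction | simp
  simp only [evenColE, evenCol_pairIdx_zero, Nat.cast_add, h1, h2, zero_add, h3]
  by_cases h5 : (s : ℕ) = 0
  · simp [h5]; split_ifs <;> ring
  · rw [if_neg h5, h4 h5]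
    split_ifs with h6 h7 h7
    · simp [h7]; ring
    · simp; ring
    · simp [h7]; ring
    · simp

theorem evenFrame_form_f (hr : 2 ≤ r) (s t : Fin r) :
    ((evenFrame r)ᵀ * (modelJ (2 * r) * (modelF (2 * r) * evenFrame r)))
      (pairIdx s 0) (pairIdx t 0) =
        -(-1) ^ r * if (s : ℕ) + 1 = r ∧ (t : ℕ) + 1 = r then 1 else 0 := by
  have hs := s.2
  have ht := t.2
  rw [evenFrame_form_apply (Y := evenColF r) hr (modelF_mul_apply evenFrame_apply)]
  have h3 : evenA r t (2 * r - 1 - 1) = 0 := by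
    simp only [evenA]
    split_ifs <;> first | omega | contradiction | simp
  have h4 : (s : ℕ) ≠ 0 → evenA r t (2 * r - 1 - s - 1) =
      if (s : ℕ) + 1 = r ∧ (t : ℕ) + 1 = r then (-1) ^ r else 0 := by
    intro h
    simp only [evenA]
    split_ifs <;> first | omega | contradiction | simp
  simp only [evenColF, evenCol_pairIdx_zero, h3]
  rw [if_neg (by omega), if_pos trivial, if_neg (by omega : ¬ 2 * r - 1 - (s : ℕ) = 0)]
  by_cases h5 : (s : ℕ) = 0
  · rw [if_pos h5, if_neg (by omega)]; simp
  · rw [if_neg h5, h4 h5]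
    split_ifs with h6
    · have h7 : (-1 : ℂ) ^ r = -(-1) ^ (s : ℕ) :=
        (congrArg ((-1 : ℂ) ^ ·) h6.1.symm).trans (by simp [pow_succ])
      have := neg_one_pow_mul_self r
      linear_combination (-1 : ℂ) ^ (s : ℕ) * this + h7
    · simp

theorem evenFrame_det (hr : 2 ≤ r) : IsUnit (evenFrame r).det := by
  refine Matrix.isUnit_det_of_monomial (J := (evenFrame r)ᵀ * (modelJ (2 * r) * evenFrame r))
    (fun i => ⟨2 * (i / 2) + (1 - i % 2), by omega⟩) (fun i => by ext; simp only; omega)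
    (fun i j => ?_) (Matrix.mul_assoc _ _ _).symm
  obtain ⟨s, ε, rfl⟩ := exists_pairIdx i
  obtain ⟨t, δ, rfl⟩ := exists_pairIdx j
  rw [evenFrame_form hr, Fin.ext_iff, Fin.ext_iff, ne_eq, Fin.ext_iff]
  simp only [pairIdx]
  omega

theorem exists_lowestWeight_model_even {V : Type*} [AddCommGroup V] [Module ℂ V]
    [FiniteDimensional ℂ V] [Nontrivial V] (hr : 2 ≤ r)
    {ρ : Matrix (Fin (2 * r)) (Fin (2 * r)) ℂ →ₗ[ℂ] End ℂ V} (hρ : IsIrrRep ρ) :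
    ∃ d < 2 * r, ∃ u, u ≠ 0 ∧ ρ (modelH _) u = (-(d : ℕ) : ℂ) • u ∧ ρ (modelF _) u = 0 := by
  have hP := evenFrame_det hr
  have hρP := hρ.conjRep hP
  obtain ⟨κ, l, v, hv0, hl, hv⟩ := hρP.exists_twist_isHighest (by omega)
  have s := (isFormSl2_model (n := 2 * r)).conj hP
  have hρ' := hρP.twist κ
  let η₀ : Fin (2 * r) → ℂ := Pi.single ⟨2 * r - 1, by omega⟩ 1
  have hη : ∀ X : Matrix (Fin (2 * r)) (Fin (2 * r)) ℂ,
      ((evenFrame r)⁻¹ * X * evenFrame r)ᵀ *ᵥ ((evenFrame r)ᵀ *ᵥ η₀) =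
        (evenFrame r)ᵀ *ᵥ (Xᵀ *ᵥ η₀) := by
    intro X
    rw [mulVec_mulVec, mulVec_mulVec, ← transpose_mul, Matrix.mul_assoc, ← Matrix.mul_assoc,
      Matrix.mul_nonsing_inv _ hP, Matrix.one_mul, transpose_mul]
  have h1 : ((2 * r - 1 : ℕ) : ℂ) = 2 * r - 1 := by rw [Nat.cast_sub (by omega)]; simp
  have hH : (modelH (2 * r))ᵀ *ᵥ η₀ = (-(2 * r - 1 : ℕ) : ℂ) • η₀ := by
    ext i
    simp only [η₀, mulVec_single_one, Matrix.col_apply, transpose_apply, modelH, Matrix.of_apply,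
      Pi.smul_apply, Pi.single_apply, Fin.ext_iff]
    split_ifs
    · simp [h1]; ring
    · simp
  have hE : (modelE (2 * r))ᵀ *ᵥ η₀ = 0 := by
    ext i
    simp only [η₀, mulVec_single_one, Matrix.col_apply, transpose_apply, modelE, Matrix.of_apply]
    rw [if_neg (by omega)]
    rfl
  have hF : (modelF (2 * r))ᵀ *ᵥ η₀ = Pi.single ⟨2 * r - 2, by omega⟩ 1 := by
    ext i
    simp only [η₀, mulVec_single_one, Matrix.col_apply, transpose_apply, modelF, Matrix.of_apply,
      Pi.single_apply, Fin.ext_iff]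
    congr 1
    simp only [eq_iff_iff]
    omega
  obtain ⟨d, hd, u, hu0, hu, hu'⟩ := exists_lowestWeight_of_evenFrame hρ'.isRep hρ'.irr
    (s.isSl2 hρ'.isRep) hl hv0 hv s (evenFrame_form_transpose hr) (evenFrame_form hr)
    (N := 2 * r - 1) (by omega) (η := (evenFrame r)ᵀ *ᵥ η₀)
    (by rw [hη, hH, mulVec_smul]) (by rw [hη, hE, mulVec_zero])
    (fun a => by
      simp only [η₀, mulVec_single_one, Matrix.col_apply, transpose_apply, evenFrame_apply,
        evenCol_pairIdx_zero, evenA]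
      have := a.2
      split_ifs <;> first | omega | simp)
    (fun a => by
      rw [hη, hF]
      simp only [mulVec_single_one, Matrix.col_apply, transpose_apply, evenFrame_apply,
        evenCol_pairIdx_zero, evenA]
      have := a.2
      split_ifs <;> first | omega | simp)
    (fun a b => by rw [conj_form_mul hP, evenFrame_form_h hr])
    (fun a b a' b' => by
      rw [conj_form_mul hP, conj_form_mul hP, evenFrame_form_e hr, evenFrame_form_f hr]
      refine ⟨(2 * r - 1) * (((if (a : ℕ) = 1 then 1 else 0) + if (b : ℕ) = 1 then 1 else 0) *
        if (a' : ℕ) + 1 = r ∧ (b' : ℕ) + 1 = r then 1 else 0), ?_⟩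
      rw [Nat.cast_mul, Nat.cast_mul, Nat.cast_add, Nat.cast_ite, Nat.cast_ite, Nat.cast_ite,
        Nat.cast_zero, Nat.cast_one]
      generalize ((2 * r - 1 : ℕ) : ℂ) = N
      generalize ((if (a : ℕ) = 1 then (1 : ℂ) else 0) + if (b : ℕ) = 1 then 1 else 0) = x
      generalize (if (a' : ℕ) + 1 = r ∧ (b' : ℕ) + 1 = r then (1 : ℂ) else 0) = y
      linear_combination N * x * y * neg_one_pow_mul_self r)
  refine ⟨d, by omega, u, hu0, ?_, ?_⟩
  · simpa [twist_apply, s.trace_h, conjRep_conj ρ hP] using hu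
  · simpa [twist_apply, s.trace_f, conjRep_conj ρ hP] using hu'

end EvenFrame

theorem IsIrrRep.exists_lowestWeight_model {V : Type*} [AddCommGroup V] [Module ℂ V]
    [FiniteDimensional ℂ V] [Nontrivial V] {n : ℕ} (hn : 3 ≤ n)
    {ρ : Matrix (Fin n) (Fin n) ℂ →ₗ[ℂ] End ℂ V} (hρ : IsIrrRep ρ) :
    ∃ d < n, ∃ u, u ≠ 0 ∧ ρ (modelH n) u = (-(d : ℕ) : ℂ) • u ∧ ρ (modelF n) u = 0 := by
  obtain ⟨r, rfl | rfl⟩ := Nat.even_or_odd' n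
  · exact exists_lowestWeight_model_even (by omega) hρ
  · exact exists_lowestWeight_model_odd hρ

section Principal

variable {n : ℕ}

/-- A principal `𝔰𝔩₂`-triple is given by the model matrices in a suitable basis. -/
theorem exists_model_frame (hn : n ≠ 0) {H E F : Matrix (Fin n) (Fin n) ℂ}
    (t : IsSl2 H.mulVecLin E.mulVecLin F.mulVecLin)
    (hirr : ∀ p : Submodule ℂ (Fin n → ℂ), (∀ v ∈ p, H *ᵥ v ∈ p) → (∀ v ∈ p, E *ᵥ v ∈ p) →
      (∀ v ∈ p, F *ᵥ v ∈ p) → p = ⊥ ∨ p = ⊤) :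
    ∃ P : Matrix (Fin n) (Fin n) ℂ, IsUnit P.det ∧ H * P = P * modelH n ∧
      E * P = P * modelE n ∧ F * P = P * modelF n := by
  have : NeZero n := ⟨hn⟩
  obtain ⟨μ, hμ⟩ := Module.End.exists_eigenvalue H.mulVecLin
  obtain ⟨w, hw⟩ := hμ.exists_hasEigenvector
  obtain ⟨k, hk, hk'⟩ := exists_pow_ne_zero_of_pow_eq_zero hw.2
    (t.he.exists_pow_eq_zero two_ne_zero hw.apply_eq_smul)
  obtain ⟨v, hv⟩ : ∃ v, v = (E.mulVecLin ^ k) w := ⟨_, rfl⟩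
  have hHv := t.he.pow_apply hw.apply_eq_smul k
  rw [pow_succ', Module.End.mul_apply] at hk'
  rw [← hv] at hk hk' hHv
  obtain ⟨d, hd, -⟩ := t.exists_nat hk hHv hk'
  rw [hd] at hHv
  obtain ⟨U, hU, hU0, -, hUd, hli, hFv⟩ := t.exists_irreducible hk hHv hk'
  obtain rfl : n = d + 1 := by
    rw [← hUd, (hirr U hU.1 hU.2.1 hU.2.2).resolve_left hU0, finrank_top, Module.finrank_fin_fun]
  let P : Matrix (Fin (d + 1)) (Fin (d + 1)) ℂ :=
    Matrix.of fun i k => (F.mulVecLin ^ (k : ℕ)) v i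
  have hXP : ∀ (X : Matrix (Fin (d + 1)) (Fin (d + 1)) ℂ) i k,
      (X * P) i k = (X.mulVecLin ((F.mulVecLin ^ (k : ℕ)) v)) i := fun X i k => rfl
  refine ⟨P, ?_, ?_, ?_, ?_⟩
  · rw [← Matrix.isUnit_iff_isUnit_det, ← Matrix.linearIndependent_cols_iff_isUnit]
    exact hli
  · ext i k
    rw [hXP, t.hf.pow_apply hHv, Matrix.mul_apply]
    simp only [modelH, Matrix.of_apply, mul_ite, mul_zero, eq_comm (a := (k : ℕ)),
      Fin.sum_ite_val_eq]
    rw [dif_pos k.2]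
    simp [P]
    ring
  · ext i k
    have h : ∀ j : Fin (d + 1), (k : ℕ) = j + 1 ↔ ((k : ℕ) ≠ 0 ∧ (j : ℕ) = k - 1) := by omega
    rw [hXP, Matrix.mul_apply]
    simp only [modelE, Matrix.of_apply, mul_ite, mul_zero, h, ite_and]
    obtain ⟨k, hkd⟩ := k
    rcases k with _ | k
    · simp only [pow_zero, Module.End.one_apply, hk']
      simp
    · simp only [ne_eq, Nat.succ_ne_zero, not_false_eq_true, if_true, Fin.sum_ite_val_eq]
      rw [dif_pos (by omega), t.e_pow_f hHv hk']
      simp [P]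
      ring
  · ext i k
    rw [hXP, ← Module.End.mul_apply, ← pow_succ', Matrix.mul_apply]
    simp only [modelF, Matrix.of_apply, mul_ite, mul_zero, eq_comm (a := (k : ℕ) + 1),
      Fin.sum_ite_val_eq, mul_one]
    split_ifs with h
    · rfl
    · have : (k : ℕ) = d := by omega
      rw [this, hFv]
      rfl

end Principal

section SpecialLinear

variable {n : ℕ}

/-- The traceless part of a matrix. -/
def tracelessPart (n : ℕ) [NeZero n] : Matrix (Fin n) (Fin n) ℂ →ₗ[ℂ] sl (Fin n) ℂ :=
  LinearMap.codRestrict (LinearMap.ker (Matrix.traceLinearMap (Fin n) ℂ ℂ))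
    (LinearMap.id - ((n : ℂ)⁻¹ • Matrix.traceLinearMap (Fin n) ℂ ℂ).smulRight 1) fun X => by
      have : (n : ℂ) ≠ 0 := Nat.cast_ne_zero.2 (NeZero.ne n)
      rw [LinearMap.mem_ker]
      simp
      field_simp
      simp

theorem val_tracelessPart [NeZero n] (X : Matrix (Fin n) (Fin n) ℂ) :
    (tracelessPart n X : Matrix (Fin n) (Fin n) ℂ) = X - ((n : ℂ)⁻¹ * X.trace) • 1 := rfl

theorem trace_coe_sl (x : sl (Fin n) ℂ) : (x : Matrix (Fin n) (Fin n) ℂ).trace = 0 := x.2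

theorem tracelessPart_coe [NeZero n] (x : sl (Fin n) ℂ) : tracelessPart n x = x := by
  ext1
  rw [val_tracelessPart, trace_coe_sl]
  simp

theorem lie_tracelessPart [NeZero n] (X Y : Matrix (Fin n) (Fin n) ℂ) :
    ⁅tracelessPart n X, tracelessPart n Y⁆ = tracelessPart n (X * Y - Y * X) := by
  ext1
  rw [sl_bracket, val_tracelessPart, val_tracelessPart, val_tracelessPart, Matrix.trace_sub,
    Matrix.trace_mul_comm, sub_self]
  simp only [sub_mul, mul_sub, smul_mul_assoc, mul_smul_comm, one_mul, mul_one, mul_zero, zero_smul,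
    sub_zero]
  module

theorem isIrrRep_tracelessPart [NeZero n] {V : Type*} [AddCommGroup V] [Module ℂ V]
    [LieRingModule (sl (Fin n) ℂ) V] [LieModule ℂ (sl (Fin n) ℂ) V]
    (hirr : LieModule.IsIrreducible ℂ (sl (Fin n) ℂ) V) :
    IsIrrRep ((LieModule.toEnd ℂ (sl (Fin n) ℂ) V : _ →ₗ[ℂ] End ℂ V) ∘ₗ tracelessPart n) where
  isRep X Y v := by
    simp only [LinearMap.comp_apply, ← lie_tracelessPart]
    exact (leibniz_lie _ _ _).trans (add_comm _ _)
  irr W hW := by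
    let N : LieSubmodule ℂ (sl (Fin n) ℂ) V :=
      { W with
        lie_mem := fun {x m} hm => by
          have := hW x m hm
          simp only [LinearMap.comp_apply, tracelessPart_coe] at this
          exact this }
    have hN : (N : Submodule ℂ V) = W := rfl
    rcases hirr.eq_bot_or_eq_top N with h | h
    · left; rw [← hN, h]; rfl
    · right; rw [← hN, h]; rfl

/-- The standard semisimple element of `𝔰𝔩₂`. -/
abbrev slH : sl (Fin 2) ℂ := singleSubSingle 0 1 1

/-- The standard raising element of `𝔰𝔩₂`. -/
abbrev slE : sl (Fin 2) ℂ := single 0 1 (by decide) 1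

/-- The standard lowering element of `𝔰𝔩₂`. -/
abbrev slF : sl (Fin 2) ℂ := single 1 0 (by decide) 1

theorem lie_slH_slE : ⁅slH, slE⁆ = (2 : ℂ) • slE := by
  ext i j
  simp only [sl_bracket]
  fin_cases i <;> fin_cases j <;> simp [Matrix.mul_apply, Matrix.single] <;> norm_num

theorem lie_slH_slF : ⁅slH, slF⁆ = (-2 : ℂ) • slF := by
  ext i j
  simp only [sl_bracket]
  fin_cases i <;> fin_cases j <;> simp [Matrix.mul_apply, Matrix.single] <;> norm_num

theorem lie_slE_slF : ⁅slE, slF⁆ = slH := by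
  ext i j
  simp only [sl_bracket]
  fin_cases i <;> fin_cases j <;> simp [Matrix.mul_apply, Matrix.single]

theorem eq_sl_two (x : sl (Fin 2) ℂ) :
    x = x.1 0 0 • slH + x.1 0 1 • slE + x.1 1 0 • slF := by
  have hx := trace_coe_sl x
  rw [Matrix.trace_fin_two] at hx
  ext i j
  fin_cases i <;> fin_cases j <;> simp [Matrix.single]
  linear_combination hx

theorem isSl2_of_sl_two {V : Type*} [AddCommGroup V] [Module ℂ V]
    {φ : sl (Fin 2) ℂ →ₗ[ℂ] End ℂ V} (hφ : ∀ x y v, φ x (φ y v) = φ y (φ x v) + φ ⁅x, y⁆ v) :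
    IsSl2 (φ slH) (φ slE) (φ slF) := by
  refine ⟨fun v => ?_, fun v => ?_, fun v => ?_⟩
  · rw [hφ, lie_slH_slE, map_smul]; rfl
  · rw [hφ, lie_slH_slF, map_smul]; rfl
  · rw [hφ, lie_slE_slF]

theorem mem_of_sl_two {V : Type*} [AddCommGroup V] [Module ℂ V]
    (φ : sl (Fin 2) ℂ →ₗ[ℂ] End ℂ V) {U : Submodule ℂ V} (hh : ∀ v ∈ U, φ slH v ∈ U)
    (he : ∀ v ∈ U, φ slE v ∈ U) (hf : ∀ v ∈ U, φ slF v ∈ U) (x : sl (Fin 2) ℂ) :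
    ∀ v ∈ U, φ x v ∈ U := by
  intro v hv
  rw [eq_sl_two x, map_add, map_add, map_smul, map_smul, map_smul]
  exact U.add_mem (U.add_mem (U.smul_mem _ (hh v hv)) (U.smul_mem _ (he v hv)))
    (U.smul_mem _ (hf v hv))

end SpecialLinear

/-- Fix `n ≥ 3` and let `𝔰` be a principal `𝔰𝔩₂`-subalgebra of
`𝔰𝔩_n(ℂ)`, i.e. the image of an injective Lie algebra homomorphism
`π : 𝔰𝔩₂(ℂ) → 𝔰𝔩_n(ℂ)` obtained from an irreducible `n`-dimensional representation of
`𝔰𝔩₂(ℂ)` (the hypothesis `hprin` says that the defining action of `𝔰𝔩_n(ℂ)` on `ℂⁿ`,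
pulled back through `π`, is irreducible).  Then for every finite-dimensional complex
irreducible representation `V` of `𝔰𝔩_n(ℂ)` there is a `d` with `0 ≤ d < n` such that
the restriction of `V` to `𝔰` contains the irreducible `𝔰𝔩₂`-representation `F_d` of
dimension `d + 1` as a subrepresentation (here: a `π`-invariant subspace `U ≤ V` which
is an irreducible `𝔰`-subrepresentation of dimension `d + 1`). -/
theorem principal_sl2_contains_small_irrep
    (n : ℕ) (hn : 3 ≤ n)
    (π : ↥(sl (Fin 2) ℂ) →ₗ⁅ℂ⁆ ↥(sl (Fin n) ℂ))
    (hinj : Function.Injective π)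
    (hprin : ∀ p : Submodule ℂ (Fin n → ℂ),
      (∀ (x : ↥(sl (Fin 2) ℂ)), ∀ v ∈ p,
        Matrix.mulVec ((π x : ↥(sl (Fin n) ℂ)) : Matrix (Fin n) (Fin n) ℂ) v ∈ p) →
      p = ⊥ ∨ p = ⊤)
    (V : Type) [AddCommGroup V] [Module ℂ V]
    [LieRingModule ↥(sl (Fin n) ℂ) V] [LieModule ℂ ↥(sl (Fin n) ℂ) V]
    [FiniteDimensional ℂ V]
    (hirr : LieModule.IsIrreducible ℂ ↥(sl (Fin n) ℂ) V) :
    ∃ d : ℕ, d < n ∧ ∃ U : Submodule ℂ V,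
      (∀ (x : ↥(sl (Fin 2) ℂ)), ∀ v ∈ U, ⁅π x, v⁆ ∈ U) ∧
      U ≠ ⊥ ∧
      (∀ U' : Submodule ℂ V, U' ≤ U →
        (∀ (x : ↥(sl (Fin 2) ℂ)), ∀ v ∈ U', ⁅π x, v⁆ ∈ U') → U' = ⊥ ∨ U' = U) ∧
      Module.finrank ℂ ↥U = d + 1 := by
  have : NeZero n := ⟨by omega⟩
  have : Nontrivial V := LieModule.nontrivial_of_isIrreducible ℂ (sl (Fin n) ℂ) V
  let ψ : sl (Fin 2) ℂ →ₗ[ℂ] End ℂ (Fin n → ℂ) :=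
    (Matrix.toLin' : Matrix (Fin n) (Fin n) ℂ ≃ₗ[ℂ] _).toLinearMap ∘ₗ
      (LinearMap.ker (Matrix.traceLinearMap (Fin n) ℂ ℂ)).subtype ∘ₗ
        (π : sl (Fin 2) ℂ →ₗ[ℂ] sl (Fin n) ℂ)
  have hψ : ∀ x y v, ψ x (ψ y v) = ψ y (ψ x v) + ψ ⁅x, y⁆ v := by
    intro x y v
    change (π x).1 *ᵥ ((π y).1 *ᵥ v) = (π y).1 *ᵥ ((π x).1 *ᵥ v) + (π ⁅x, y⁆).1 *ᵥ v
    rw [LieHom.map_lie, sl_bracket, mulVec_mulVec, mulVec_mulVec, sub_mulVec]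
    abel
  obtain ⟨P, hP, hPH, -, hPF⟩ := exists_model_frame (by omega) (H := (π slH).1) (E := (π slE).1)
    (F := (π slF).1) (isSl2_of_sl_two hψ)
    (fun p hh he hf => hprin p (mem_of_sl_two ψ hh he hf))
  let ρ := (LieModule.toEnd ℂ (sl (Fin n) ℂ) V : _ →ₗ[ℂ] End ℂ V) ∘ₗ tracelessPart n
  have hρ : IsIrrRep ρ := isIrrRep_tracelessPart hirr
  have hact : ∀ (x : sl (Fin n) ℂ) (M : Matrix (Fin n) (Fin n) ℂ), x.1 * P = P * M →
      conjRep ρ P M = LieModule.toEnd ℂ (sl (Fin n) ℂ) V x := by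
    intro x M hx
    rw [conjRep_apply, ← hx, Matrix.mul_assoc, Matrix.mul_nonsing_inv _ hP, Matrix.mul_one]
    exact congrArg (LieModule.toEnd ℂ (sl (Fin n) ℂ) V) (tracelessPart_coe x)
  obtain ⟨d, hd, u, hu0, hu, hu'⟩ := (hρ.conjRep hP).exists_lowestWeight_model hn
  rw [hact _ _ hPH] at hu
  rw [hact _ _ hPF] at hu'
  let φ : sl (Fin 2) ℂ →ₗ[ℂ] End ℂ V :=
    (LieModule.toEnd ℂ (sl (Fin n) ℂ) V : _ →ₗ[ℂ] End ℂ V) ∘ₗ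
      (π : sl (Fin 2) ℂ →ₗ[ℂ] sl (Fin n) ℂ)
  have hφ : ∀ x y v, φ x (φ y v) = φ y (φ x v) + φ ⁅x, y⁆ v := by
    intro x y v
    change ⁅π x, ⁅π y, v⁆⁆ = ⁅π y, ⁅π x, v⁆⁆ + ⁅π ⁅x, y⁆, v⁆
    rw [LieHom.map_lie, leibniz_lie, add_comm]
  have t : IsSl2 (φ slH) (φ slE) (φ slF) := isSl2_of_sl_two hφ
  obtain ⟨U, ⟨hUh, hUf, hUe⟩, hU0, hUirr, hUd, -⟩ := t.symm.exists_irreducible (d := d) hu0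
    (by rw [LinearMap.neg_apply]; exact (neg_eq_iff_eq_neg.2 (hu.trans (neg_smul _ _)))) hu'
  refine ⟨d, hd, U, mem_of_sl_two φ
    (fun v hv => by simpa using U.neg_mem (hUh v hv)) hUe hUf, hU0, fun U' hU' hst => ?_, hUd⟩
  exact hUirr U' hU' ⟨fun w hw => U'.neg_mem (hst slH w hw), hst slF, hst slE⟩
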